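/- arXiv:2410.03047 — 10 statements merged into one kernel-verified Lean document; each statement's English description precedes it below -/
import Mathlib

section
/- Let t₁, t₂, t₃, t₄ be real numbers with t₁ < t₂ < t₃ < t₄ < t₁ + 1, and write ζ(s) = Complex.exp (2·π·Complex.I·s). Let α, β : Set.Icc (0:ℝ) 1 → ℂ be continuous maps whose values lie in the closed unit disk (‖α t‖ ≤ 1 and ‖β t‖ ≤ 1 for all t), with α 0 = ζ(t₁), α 1 = ζ(t₃), β 0 = ζ(t₂), β 1 = ζ(t₄). Then the images of α and β intersect: there exist s, s' in Set.Icc (0:ℝ) 1 with α s = β s'. -/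
/-- `zeta s = exp(2πis)`, the point of the unit circle with angle parameter `s`. -/
noncomputable def zeta (s : ℝ) : ℂ :=
  Complex.exp (2 * (Real.pi : ℂ) * Complex.I * (s : ℂ))

theorem zeta_ne_zero (t : ℝ) : zeta t ≠ 0 := Complex.exp_ne_zero _

theorem norm_zeta (t : ℝ) : ‖zeta t‖ = 1 := by
  simp [zeta, Complex.norm_exp]

theorem zeta_add_one (t : ℝ) : zeta (t + 1) = zeta t := by
  rw [zeta, zeta, ← Complex.exp_periodic (2 * Real.pi * Complex.I * t)]
  congr 1
  push_cast
  ring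

theorem zeta_div_zeta (s t : ℝ) : zeta s / zeta t = zeta (s - t) := by
  simp only [zeta, ← Complex.exp_sub]
  congr 1
  push_cast
  ring

theorem one_sub_zeta (u : ℝ) :
    1 - zeta u = ((2 * Real.sin (Real.pi * u) : ℝ) : ℂ) *
      (Complex.cos ((Real.pi * u - Real.pi / 2 : ℝ) : ℂ) +
        Complex.sin ((Real.pi * u - Real.pi / 2 : ℝ) : ℂ) * Complex.I) := by
  have h : zeta u = Complex.cos ((2 * (Real.pi * u) : ℝ) : ℂ) +
      Complex.sin ((2 * (Real.pi * u) : ℝ) : ℂ) * Complex.I := by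
    rw [zeta, ← Complex.exp_mul_I]
    congr 1
    push_cast
    ring
  rw [h]
  simp only [← Complex.ofReal_cos, ← Complex.ofReal_sin, Real.cos_two_mul, Real.sin_two_mul,
    Real.cos_sub_pi_div_two, Real.sin_sub_pi_div_two]
  push_cast
  linear_combination (-2) * Complex.sin_sq_add_cos_sq (Real.pi * u)

theorem log_one_sub_zeta_im {u : ℝ} (h0 : 0 < u) (h1 : u < 1) :
    (Complex.log (1 - zeta u)).im = Real.pi * u - Real.pi / 2 := by
  have hπ := Real.pi_pos
  rw [Complex.log_im, one_sub_zeta]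
  refine Complex.arg_mul_cos_add_sin_mul_I ?_ ⟨by nlinarith, by nlinarith⟩
  have := Real.sin_pos_of_pos_of_lt_pi (x := Real.pi * u) (by positivity) (by nlinarith)
  positivity

/-- A point of the closed unit disk other than `1` has `1 - w` in the slit plane. -/
theorem one_sub_mem_slitPlane {w : ℂ} (hw : ‖w‖ ≤ 1) (hw1 : w ≠ 1) :
    1 - w ∈ Complex.slitPlane := by
  rw [Complex.mem_slitPlane_iff]
  by_contra! h
  obtain ⟨h1, h2⟩ := h
  have h3 := (Complex.re_le_norm w).trans hw
  simp only [Complex.sub_re, Complex.one_re, Complex.sub_im, Complex.one_im] at h1 h2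
  exact hw1 (Complex.ext (by simp; linarith) (by simp; linarith))

/-- Continuous functions on a preconnected space with the same exponential and a common value
are equal. -/
theorem Complex.eq_of_exp_comp_eq {X : Type*} [TopologicalSpace X] [PreconnectedSpace X]
    {f g : X → ℂ} (hf : Continuous f) (hg : Continuous g)
    (h : ∀ x, Complex.exp (f x) = Complex.exp (g x)) {a : X} (ha : f a = g a) : f = g :=
  Complex.isCoveringMap_exp.eq_of_comp_eq hf hg (funext fun x ↦ Subtype.ext (h x)) a ha

/-- A continuous logarithm of `c * (ζ - γ)`, with `γ` a path in the closed unit disk avoiding the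
boundary point `ζ`, varies like the principal logarithm of `1 - γ / ζ`. -/
theorem log_sub_log_of_exp_eq {γ g : ℝ → ℂ} (hγ : Continuous γ) (hg : Continuous g)
    (hγd : ∀ x, ‖γ x‖ ≤ 1) {t : ℝ} (hne : ∀ x, γ x ≠ zeta t) {c : ℂ}
    (h : ∀ x, Complex.exp (g x) = c * (zeta t - γ x)) (a b : ℝ) :
    g b - g a = Complex.log (1 - γ b / zeta t) - Complex.log (1 - γ a / zeta t) := by
  have hz := zeta_ne_zero t
  have hslit (x : ℝ) : 1 - γ x / zeta t ∈ Complex.slitPlane := by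
    refine one_sub_mem_slitPlane ?_ ?_
    · rw [norm_div, norm_zeta, div_one]
      exact hγd x
    · rw [Ne, div_eq_one_iff_eq hz]
      exact hne x
  have hlog (x : ℝ) : Complex.exp (Complex.log (1 - γ x / zeta t)) = 1 - γ x / zeta t :=
    Complex.exp_log (Complex.slitPlane_ne_zero (hslit x))
  have hcont : Continuous fun x ↦ Complex.log (1 - γ x / zeta t) :=
    Continuous.clog (by fun_prop) hslit
  have key : g = fun x ↦ Complex.log (1 - γ x / zeta t) +
      (g a - Complex.log (1 - γ a / zeta t)) := by
    refine Complex.eq_of_exp_comp_eq hg (hcont.add continuous_const) (fun x ↦ ?_) (a := a) (by ring)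
    have ha := Complex.slitPlane_ne_zero (hslit a)
    rw [Complex.exp_add, Complex.exp_sub, hlog, hlog, h, h]
    have ha' : zeta t - γ a ≠ 0 := sub_ne_zero.mpr (hne a).symm
    field_simp
  have hb := congrFun key b
  rw [hb]
  ring

/-- A nowhere vanishing continuous function on a simply connected, locally path connected space
has a continuous logarithm. -/
theorem exists_continuous_exp_eq {X : Type*} [TopologicalSpace X] [SimplyConnectedSpace X]
    [LocallyPathConnectedSpace X] {f : X → ℂ} (hf : Continuous f) (h0 : ∀ x, f x ≠ 0) :
    ∃ g : X → ℂ, Continuous g ∧ ∀ x, Complex.exp (g x) = f x := by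
  obtain ⟨x₀⟩ : Nonempty X := inferInstance
  obtain ⟨g, ⟨-, hg⟩, -⟩ := Complex.isCoveringMapOn_exp.existsUnique_continuousMap_lifts
    ⟨f, hf⟩ (a₀ := x₀) (Complex.exp_log (h0 x₀)) h0
  exact ⟨g, g.continuous, fun x ↦ congrFun hg x⟩

/-- The version of the crossing theorem for paths parametrized by the whole real line. -/
theorem exists_eq_of_interleaved {t₁ t₂ t₃ t₄ : ℝ} (h12 : t₁ < t₂) (h23 : t₂ < t₃)
    (h34 : t₃ < t₄) (h41 : t₄ < t₁ + 1) {α β : ℝ → ℂ} (hαc : Continuous α) (hβc : Continuous β)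
    (hαd : ∀ t, ‖α t‖ ≤ 1) (hβd : ∀ t, ‖β t‖ ≤ 1) (hα0 : α 0 = zeta t₁) (hα1 : α 1 = zeta t₃)
    (hβ0 : β 0 = zeta t₂) (hβ1 : β 1 = zeta t₄) : ∃ s s', α s = β s' := by
  by_contra! hne
  obtain ⟨G, hG, hexp⟩ := exists_continuous_exp_eq (X := ℝ × ℝ) (f := fun p ↦ α p.1 - β p.2)
    (by fun_prop) fun p ↦ sub_ne_zero.mpr (hne _ _)
  have bottom := log_sub_log_of_exp_eq (g := fun s ↦ G (s, 0)) (t := t₂) (c := -1) hαc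
    (by fun_prop) hαd (fun s ↦ hβ0 ▸ hne s 0) (fun s ↦ by rw [hexp, hβ0]; ring) 0 1
  have top := log_sub_log_of_exp_eq (g := fun s ↦ G (s, 1)) (t := t₄) (c := -1) hαc
    (by fun_prop) hαd (fun s ↦ hβ1 ▸ hne s 1) (fun s ↦ by rw [hexp, hβ1]; ring) 0 1
  have left := log_sub_log_of_exp_eq (g := fun s ↦ G (0, s)) (t := t₁) (c := 1) hβc
    (by fun_prop) hβd (fun s ↦ hα0 ▸ (hne 0 s).symm) (fun s ↦ by rw [hexp, hα0]; ring) 0 1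
  have right := log_sub_log_of_exp_eq (g := fun s ↦ G (1, s)) (t := t₃) (c := 1) hβc
    (by fun_prop) hβd (fun s ↦ hα1 ▸ (hne 1 s).symm) (fun s ↦ by rw [hexp, hα1]; ring) 0 1
  rw [hα0, hα1, ← zeta_add_one t₁, zeta_div_zeta, zeta_div_zeta] at bottom
  rw [hα0, hα1, ← zeta_add_one t₁, ← zeta_add_one t₃, zeta_div_zeta, zeta_div_zeta] at top
  rw [hβ0, hβ1, zeta_div_zeta, zeta_div_zeta] at left
  rw [hβ0, hβ1, ← zeta_add_one t₂, zeta_div_zeta, zeta_div_zeta] at right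
  have total := congrArg Complex.im (congrArg₂ (· - ·) (congrArg₂ (· + ·) bottom right)
    (congrArg₂ (· + ·) left top))
  simp only [Complex.sub_im, Complex.add_im] at total
  repeat rw [log_one_sub_zeta_im (by linarith) (by linarith)] at total
  nlinarith [Real.pi_pos]

/-- Two paths in the closed unit disk joining interleaved boundary points must cross. -/
theorem stmt_0 (t₁ t₂ t₃ t₄ : ℝ) (h12 : t₁ < t₂) (h23 : t₂ < t₃) (h34 : t₃ < t₄)
    (h41 : t₄ < t₁ + 1) (α β : Set.Icc (0:ℝ) 1 → ℂ)
    (hαc : Continuous α) (hβc : Continuous β)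
    (hαd : ∀ t, ‖α t‖ ≤ 1) (hβd : ∀ t, ‖β t‖ ≤ 1)
    (hα0 : α ⟨0, by norm_num⟩ = zeta t₁) (hα1 : α ⟨1, by norm_num⟩ = zeta t₃)
    (hβ0 : β ⟨0, by norm_num⟩ = zeta t₂) (hβ1 : β ⟨1, by norm_num⟩ = zeta t₄) :
    ∃ s s' : Set.Icc (0:ℝ) 1, α s = β s' := by
  obtain ⟨s, s', h⟩ := exists_eq_of_interleaved h12 h23 h34 h41
    (α := fun x ↦ α (Set.projIcc 0 1 zero_le_one x))
    (β := fun x ↦ β (Set.projIcc 0 1 zero_le_one x))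
    (hαc.comp continuous_projIcc) (hβc.comp continuous_projIcc) (fun _ ↦ hαd _) (fun _ ↦ hβd _)
    (by rw [Set.projIcc_left]; exact hα0) (by rw [Set.projIcc_right]; exact hα1)
    (by rw [Set.projIcc_left]; exact hβ0) (by rw [Set.projIcc_right]; exact hβ1)
  exact ⟨_, _, h⟩
end

section
/- Let d ≥ 1 and let P be a partition of Fin d (a Finpartition of Finset.univ : Finset (Fin d)). Write ζ(m) = Complex.exp (2·π·Complex.I·(m : ℕ)/d) for m : Fin d, so ζ enumerates the d-th roots of unity. Say P is combinatorially noncrossing if whenever i < j < k < l in Fin d (in the order inherited from ℕ) with i and k in the same block of P and j and l in the same block of P, then i and j are in the same block of P. Then P is combinatorially noncrossing if and only if for every two distinct blocks B, B' of P the convex hulls convexHull ℝ (ζ '' B) and convexHull ℝ (ζ '' B') (taken in ℂ viewed as a real vector space) are disjoint. -/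
/-- `rootOfUnityPt d m = exp(2πi·m/d)`, the `m`-th of the `d`-th roots of unity. -/
noncomputable def rootOfUnityPt (d : ℕ) (m : Fin d) : ℂ :=
  Complex.exp (2 * (Real.pi : ℂ) * Complex.I * ((m : ℕ) : ℂ) / (d : ℂ))

namespace NoncrossingHull

/-- The argument of the `m`-th of the `d`-th roots of unity. -/
noncomputable def angle {d : ℕ} (m : Fin d) : ℝ := 2 * Real.pi * (m : ℕ) / d

lemma rootOfUnityPt_eq {d : ℕ} (m : Fin d) :
    rootOfUnityPt d m = Complex.exp ((angle m : ℝ) * Complex.I) := by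
  unfold rootOfUnityPt angle
  congr 1
  push_cast
  ring

lemma rootOfUnityPt_re {d : ℕ} (m : Fin d) : (rootOfUnityPt d m).re = Real.cos (angle m) := by
  rw [rootOfUnityPt_eq, Complex.exp_ofReal_mul_I_re]

lemma rootOfUnityPt_im {d : ℕ} (m : Fin d) : (rootOfUnityPt d m).im = Real.sin (angle m) := by
  rw [rootOfUnityPt_eq, Complex.exp_ofReal_mul_I_im]

lemma sin_half_angle_sub_pos {d : ℕ} {a b : Fin d} (h : a < b) :
    0 < Real.sin ((angle b - angle a) / 2) := by
  have hd : (0 : ℝ) < d := by exact_mod_cast a.pos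
  have hab : ((a : ℕ) : ℝ) < (b : ℕ) := by exact_mod_cast h
  have hb : ((b : ℕ) : ℝ) < d := by exact_mod_cast b.isLt
  have ha : (0 : ℝ) ≤ (a : ℕ) := by positivity
  have hlin : (angle b - angle a) / 2 = Real.pi * (((b : ℕ) - (a : ℕ) : ℝ) / d) := by
    unfold angle
    ring
  rw [hlin]
  apply Real.sin_pos_of_pos_of_lt_pi
  · exact mul_pos Real.pi_pos (div_pos (sub_pos.2 hab) hd)
  · exact mul_lt_of_lt_one_right Real.pi_pos ((div_lt_one hd).2 (by linarith))

lemma sin_half_angle_sub_nonneg {d : ℕ} {a b : Fin d} (h : a ≤ b) :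
    0 ≤ Real.sin ((angle b - angle a) / 2) := by
  rcases h.eq_or_lt with rfl | h
  · simp
  · exact (sin_half_angle_sub_pos h).le

lemma sin_half_angle_sub_swap {d : ℕ} (a b : Fin d) :
    Real.sin ((angle b - angle a) / 2) = -Real.sin ((angle a - angle b) / 2) := by
  rw [← Real.sin_neg]
  ring_nf

/-- The functional whose zero set is the line through the roots of unity with indices `a`, `b`
(the tangent line if `a = b`), up to its constant term. -/
noncomputable def chordForm {d : ℕ} (a b : Fin d) (z : ℂ) : ℝ :=
  Real.cos ((angle a + angle b) / 2) * z.re + Real.sin ((angle a + angle b) / 2) * z.im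

lemma isLinearMap_chordForm {d : ℕ} (a b : Fin d) : IsLinearMap ℝ (chordForm a b) where
  map_add x y := by simp only [chordForm, Complex.add_re, Complex.add_im]; ring
  map_smul c x := by simp only [chordForm, Complex.smul_re, Complex.smul_im, smul_eq_mul]; ring

lemma chordForm_rootOfUnityPt {d : ℕ} (a b m : Fin d) :
    chordForm a b (rootOfUnityPt d m) = Real.cos ((angle b - angle a) / 2) +
      2 * (Real.sin ((angle m - angle a) / 2) * Real.sin ((angle b - angle m) / 2)) := by
  have h₁ := Real.cos_sub (angle m) ((angle a + angle b) / 2)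
  have h₂ := Real.cos_sub_cos (angle m - (angle a + angle b) / 2) ((angle b - angle a) / 2)
  have h₃ : (angle m - (angle a + angle b) / 2 - (angle b - angle a) / 2) / 2 =
    -((angle b - angle m) / 2) := by ring
  have h₄ : (angle m - (angle a + angle b) / 2 + (angle b - angle a) / 2) / 2 =
    (angle m - angle a) / 2 := by ring
  rw [h₃, h₄, Real.sin_neg] at h₂
  rw [chordForm, rootOfUnityPt_re, rootOfUnityPt_im]
  linarith

lemma chordForm_le {d : ℕ} {a b m : Fin d} (hab : a ≤ b) (h : m ≤ a ∨ b ≤ m) :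
    chordForm a b (rootOfUnityPt d m) ≤ Real.cos ((angle b - angle a) / 2) := by
  rw [chordForm_rootOfUnityPt]
  rcases h with h | h
  · have h₁ := sin_half_angle_sub_nonneg h
    have h₂ := sin_half_angle_sub_nonneg (h.trans hab)
    rw [sin_half_angle_sub_swap a m]
    nlinarith [mul_nonneg h₁ h₂]
  · have h₁ := sin_half_angle_sub_nonneg h
    have h₂ := sin_half_angle_sub_nonneg (hab.trans h)
    rw [sin_half_angle_sub_swap m b]
    nlinarith [mul_nonneg h₁ h₂]

lemma chordForm_lt {d : ℕ} {a b m : Fin d} (hab : a ≤ b) (h : b < m) :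
    chordForm a b (rootOfUnityPt d m) < Real.cos ((angle b - angle a) / 2) := by
  rw [chordForm_rootOfUnityPt, sin_half_angle_sub_swap m b]
  nlinarith [mul_pos (sin_half_angle_sub_pos h) (sin_half_angle_sub_pos (hab.trans_lt h))]

lemma le_chordForm {d : ℕ} {a b m : Fin d} (ha : a ≤ m) (hb : m ≤ b) :
    Real.cos ((angle b - angle a) / 2) ≤ chordForm a b (rootOfUnityPt d m) := by
  rw [chordForm_rootOfUnityPt]
  nlinarith [mul_nonneg (sin_half_angle_sub_nonneg ha) (sin_half_angle_sub_nonneg hb)]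

lemma lt_chordForm {d : ℕ} {a b m : Fin d} (ha : a < m) (hb : m < b) :
    Real.cos ((angle b - angle a) / 2) < chordForm a b (rootOfUnityPt d m) := by
  rw [chordForm_rootOfUnityPt]
  nlinarith [mul_pos (sin_half_angle_sub_pos ha) (sin_half_angle_sub_pos hb)]

/-- The hulls of two sets are disjoint if a linear functional separates the sets, strictly on one
side. -/
lemma disjoint_convexHull_of_le_of_lt {E : Type*} [AddCommGroup E] [Module ℝ E] {S T : Set E}
    {f : E → ℝ} (hf : IsLinearMap ℝ f) (c : ℝ) (hS : ∀ z ∈ S, f z ≤ c) (hT : ∀ z ∈ T, c < f z) :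
    Disjoint (convexHull ℝ S) (convexHull ℝ T) := by
  have h₁ : convexHull ℝ S ⊆ {z | f z ≤ c} := convexHull_min hS (convex_halfSpace_le hf c)
  have h₂ : convexHull ℝ T ⊆ {z | c < f z} := convexHull_min hT (convex_halfSpace_gt hf c)
  exact Set.disjoint_left.2 fun z hz hz' => not_lt_of_ge (show f z ≤ c from h₁ hz) (h₂ hz')

/-- As `disjoint_convexHull_of_le_of_lt`, with the inequalities on the other sides. -/
lemma disjoint_convexHull_of_lt_of_le {E : Type*} [AddCommGroup E] [Module ℝ E] {S T : Set E}
    {f : E → ℝ} (hf : IsLinearMap ℝ f) (c : ℝ) (hS : ∀ z ∈ S, f z < c) (hT : ∀ z ∈ T, c ≤ f z) :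
    Disjoint (convexHull ℝ S) (convexHull ℝ T) := by
  have h₁ : convexHull ℝ S ⊆ {z | f z < c} := convexHull_min hS (convex_halfSpace_lt hf c)
  have h₂ : convexHull ℝ T ⊆ {z | c ≤ f z} := convexHull_min hT (convex_halfSpace_ge hf c)
  exact Set.disjoint_left.2 fun z hz hz' => not_lt_of_ge (show c ≤ f z from h₂ hz') (h₁ hz)

/-- If `B` has the smallest element and `B`, `B'` do not cross, their hulls are disjoint. -/
lemma disjoint_convexHull_of_min_lt {d : ℕ} {B B' : Finset (Fin d)} (hBB' : Disjoint B B')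
    {a b' : Fin d} (ha : a ∈ B) (hmin : ∀ x ∈ B, a ≤ x) (hb' : b' ∈ B') (hmin' : ∀ x ∈ B', b' ≤ x)
    (hab : a < b')
    (hnc : ∀ i ∈ B, ∀ j ∈ B', ∀ k ∈ B, ∀ l ∈ B', i < j → j < k → ¬ k < l) :
    Disjoint (convexHull ℝ (rootOfUnityPt d '' ↑B)) (convexHull ℝ (rootOfUnityPt d '' ↑B')) := by
  have hne : ∀ x ∈ B, ∀ y ∈ B', x ≠ y := fun x hx y hy h =>
    Finset.disjoint_left.1 hBB' hx (h ▸ hy)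
  obtain ⟨t, ht, htmax⟩ := (B.filter (· < b')).exists_max_image id
    ⟨a, Finset.mem_filter.2 ⟨ha, hab⟩⟩
  simp only [Finset.mem_filter, id] at ht htmax
  by_cases hu : (B.filter (b' < ·)).Nonempty
  · obtain ⟨u, hu, humin⟩ := (B.filter (b' < ·)).exists_min_image id hu
    simp only [Finset.mem_filter, id] at hu humin
    refine disjoint_convexHull_of_le_of_lt (isLinearMap_chordForm t u)
      (Real.cos ((angle u - angle t) / 2)) ?_ ?_
    · rintro _ ⟨x, hx, rfl⟩
      refine chordForm_le (ht.2.trans hu.2).le ?_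
      rcases (hne x hx b' hb').lt_or_gt with h | h
      · exact .inl (htmax x ⟨hx, h⟩)
      · exact .inr (humin x ⟨hx, h⟩)
    · rintro _ ⟨y, hy, rfl⟩
      refine lt_chordForm (ht.2.trans_le (hmin' y hy)) ?_
      exact ((hne u hu.1 y hy).lt_or_gt).resolve_left
        (hnc t ht.1 b' hb' u hu.1 y hy ht.2 hu.2)
  · have hle : ∀ x ∈ B, x ≤ t := fun x hx => htmax x ⟨hx, (hne x hx b' hb').lt_or_gt.resolve_right
      fun h => hu ⟨x, Finset.mem_filter.2 ⟨hx, h⟩⟩⟩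
    refine (disjoint_convexHull_of_lt_of_le (isLinearMap_chordForm a t)
      (Real.cos ((angle t - angle a) / 2)) ?_ ?_).symm
    · rintro _ ⟨y, hy, rfl⟩
      exact chordForm_lt (hmin t ht.1) (ht.2.trans_le (hmin' y hy))
    · rintro _ ⟨x, hx, rfl⟩
      exact le_chordForm (hmin x hx) (hle x hx)

/-- The signed area (up to a factor) of a triangle in the plane. -/
def triangleDet (x y z : ℂ) : ℝ :=
  (y.re - x.re) * (z.im - x.im) - (y.im - x.im) * (z.re - x.re)

lemma triangleDet_rootOfUnityPt_pos {d : ℕ} {a b c : Fin d} (hab : a < b) (hbc : b < c) :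
    0 < triangleDet (rootOfUnityPt d a) (rootOfUnityPt d b) (rootOfUnityPt d c) := by
  have key : triangleDet (rootOfUnityPt d a) (rootOfUnityPt d b) (rootOfUnityPt d c) =
      4 * Real.sin ((angle b - angle a) / 2) * Real.sin ((angle c - angle b) / 2) *
        Real.sin ((angle c - angle a) / 2) := by
    simp only [triangleDet, rootOfUnityPt_re, rootOfUnityPt_im]
    have e₁ := Real.cos_sub_cos (angle b) (angle a)
    have e₂ := Real.cos_sub_cos (angle c) (angle a)
    have e₃ := Real.sin_sub_sin (angle b) (angle a)
    have e₄ := Real.sin_sub_sin (angle c) (angle a)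
    have e₅ := Real.sin_sub ((angle c + angle a) / 2) ((angle b + angle a) / 2)
    rw [show (angle c + angle a) / 2 - (angle b + angle a) / 2 = (angle c - angle b) / 2 by ring]
      at e₅
    rw [e₁, e₂, e₃, e₄, e₅]
    ring
  rw [key]
  have h₁ := sin_half_angle_sub_pos hab
  have h₂ := sin_half_angle_sub_pos hbc
  have h₃ := sin_half_angle_sub_pos (hab.trans hbc)
  positivity

/-- The diagonals of a convex quadrilateral intersect. -/
lemma segment_inter_nonempty {p q r s : ℂ} (h₁ : 0 < triangleDet q r s)
    (h₂ : 0 < triangleDet p r s) (h₃ : 0 < triangleDet p q s) (h₄ : 0 < triangleDet p q r) :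
    (segment ℝ p r ∩ segment ℝ q s).Nonempty := by
  have hsum : triangleDet q r s + triangleDet p q s = triangleDet p r s + triangleDet p q r := by
    simp only [triangleDet]
    ring
  have hpos : 0 < triangleDet q r s + triangleDet p q s := add_pos h₁ h₃
  set S := triangleDet q r s + triangleDet p q s with hS
  refine ⟨(triangleDet q r s / S) • p + (triangleDet p q s / S) • r,
    ⟨_, _, (div_pos h₁ hpos).le, (div_pos h₃ hpos).le, ?_, rfl⟩,
    ⟨triangleDet p r s / S, triangleDet p q r / S, (div_pos h₂ hpos).le, (div_pos h₄ hpos).le,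
      ?_, ?_⟩⟩
  · rw [← add_div, ← hS, div_self hpos.ne']
  · rw [← add_div, ← hsum, div_self hpos.ne']
  · have key : triangleDet p r s • q + triangleDet p q r • s =
        triangleDet q r s • p + triangleDet p q s • r := by
      apply Complex.ext <;>
      · simp only [triangleDet, Complex.add_re, Complex.add_im, Complex.smul_re, Complex.smul_im,
          smul_eq_mul]
        ring
    simp only [div_eq_inv_mul, mul_smul, ← smul_add, key]

end NoncrossingHull

open NoncrossingHull in
/-- A partition of `Fin d` is combinatorially noncrossing if and only if the convex hulls
of the corresponding sets of `d`-th roots of unity are pairwise disjoint. -/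
theorem stmt_1 (d : ℕ) (hd : 1 ≤ d) (P : Finpartition (Finset.univ : Finset (Fin d))) :
    (∀ i j k l : Fin d, i < j → j < k → k < l →
        (∃ B ∈ P.parts, i ∈ B ∧ k ∈ B) → (∃ B ∈ P.parts, j ∈ B ∧ l ∈ B) →
        ∃ B ∈ P.parts, i ∈ B ∧ j ∈ B) ↔
      (∀ B ∈ P.parts, ∀ B' ∈ P.parts, B ≠ B' →
        Disjoint (convexHull ℝ (rootOfUnityPt d '' ↑B))
          (convexHull ℝ (rootOfUnityPt d '' ↑B'))) := by
  constructor
  · intro h B hB B' hB' hne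
    have hnc : ∀ C ∈ P.parts, ∀ C' ∈ P.parts, C ≠ C' →
        ∀ i ∈ C, ∀ j ∈ C', ∀ k ∈ C, ∀ l ∈ C', i < j → j < k → ¬ k < l := by
      intro C hC C' hC' hCC' i hi j hj k hk l hl hij hjk hkl
      obtain ⟨A, hA, hiA, hjA⟩ := h i j k l hij hjk hkl ⟨C, hC, hi, hk⟩ ⟨C', hC', hj, hl⟩
      exact hCC' ((P.eq_of_mem_parts hC hA hi hiA).trans (P.eq_of_mem_parts hA hC' hjA hj))
    obtain ⟨a, ha, hmin⟩ := B.exists_min_image id (P.nonempty_of_mem_parts hB)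
    obtain ⟨b, hb, hmin'⟩ := B'.exists_min_image id (P.nonempty_of_mem_parts hB')
    have hab : a ≠ b := fun hab => hne (P.eq_of_mem_parts hB hB' ha (hab ▸ hb))
    rcases hab.lt_or_gt with hlt | hlt
    · exact disjoint_convexHull_of_min_lt (P.disjoint hB hB' hne) ha hmin hb hmin' hlt
        (hnc B hB B' hB' hne)
    · exact (disjoint_convexHull_of_min_lt (P.disjoint hB' hB hne.symm) hb hmin' ha hmin hlt
        (hnc B' hB' B hB hne.symm)).symm
  · rintro h i j k l hij hjk hkl ⟨B, hB, hi, hk⟩ ⟨B', hB', hj, hl⟩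
    by_cases hne : B = B'
    · exact ⟨B, hB, hi, hne ▸ hj⟩
    · obtain ⟨x, hx, hx'⟩ := segment_inter_nonempty
        (triangleDet_rootOfUnityPt_pos hjk hkl) (triangleDet_rootOfUnityPt_pos (hij.trans hjk) hkl)
        (triangleDet_rootOfUnityPt_pos hij (hjk.trans hkl)) (triangleDet_rootOfUnityPt_pos hij hjk)
      exact absurd
        (segment_subset_convexHull (Set.mem_image_of_mem _ hj) (Set.mem_image_of_mem _ hl) hx')
        (Set.disjoint_left.1 (h B hB B' hB' hne)
          (segment_subset_convexHull (Set.mem_image_of_mem _ hi) (Set.mem_image_of_mem _ hk) hx))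
end

section
/- Let X be a type with decidable equality, let n be a natural number, and let M be a multiset over X with Multiset.card M = n. Then the number of tuples x : Fin n → X whose multiset of coordinates equals M is the multinomial coefficient: Nat.card {x : Fin n → X // Multiset.map x Finset.univ.val = M} = Nat.multinomial M.toFinset (fun a => M.count a), i.e. it equals n! / ∏_{a ∈ M.toFinset} (M.count a)!. -/
/-- Splitting off the first coordinate: a tuple with coordinates `M` is a choice of head `a ∈ M`
together with a tuple with coordinates `M.erase a`. -/
def tupleConsEquiv {X : Type*} [DecidableEq X] (n : ℕ) (M : Multiset X) :
    {x : Fin (n + 1) → X // Multiset.map x Finset.univ.val = M} ≃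
      Σ a : M.toFinset, {x : Fin n → X // Multiset.map x Finset.univ.val = M.erase a} where
  toFun x :=
    ⟨⟨x.1 0, by
        obtain ⟨x, rfl⟩ := x
        rw [Multiset.mem_toFinset]
        exact Multiset.mem_map_of_mem _ (Finset.mem_univ_val _)⟩,
      ⟨fun i => x.1 i.succ, by
        obtain ⟨x, rfl⟩ := x
        simp [Fin.univ_succ, Function.comp_def]⟩⟩
  invFun y :=
    ⟨Fin.cons y.1.1 y.2.1, by
      obtain ⟨⟨a, ha⟩, ⟨x, hx⟩⟩ := y
      have h := Multiset.cons_erase (Multiset.mem_toFinset.1 ha)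
      simp only at hx
      rw [← hx] at h
      simpa [Fin.univ_succ, Function.comp_def] using h⟩
  left_inv x := Subtype.ext (Fin.cons_self_tail x.1)
  right_inv y := rfl

theorem Multiset.prod_factorial_count_erase {X : Type*} [DecidableEq X] {M : Multiset X} {a : X}
    (ha : a ∈ M) :
    ∏ b ∈ M.toFinset, (M.count b).factorial =
      M.count a * ∏ b ∈ (M.erase a).toFinset, ((M.erase a).count b).factorial := by
  have hsub : (M.erase a).toFinset ⊆ M.toFinset :=
    Multiset.toFinset_subset.2 (Multiset.erase_subset a M)
  rw [Finset.prod_subset hsub (fun b _ hb => by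
      rw [Multiset.mem_toFinset] at hb
      rw [Multiset.count_eq_zero_of_notMem hb, Nat.factorial_zero]),
    ← Finset.mul_prod_erase _ _ (Multiset.mem_toFinset.2 ha),
    ← Finset.mul_prod_erase _ _ (Multiset.mem_toFinset.2 ha), ← mul_assoc,
    Multiset.count_erase_self,
    Nat.mul_factorial_pred (Multiset.count_pos.2 ha).ne']
  congr 1
  refine Finset.prod_congr rfl fun b hb => ?_
  rw [Multiset.count_erase_of_ne (Finset.ne_of_mem_erase hb)]

theorem card_tuples_mul_prod_factorial_count {X : Type*} [DecidableEq X] (n : ℕ)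
    (M : Multiset X) (hM : Multiset.card M = n) :
    Nat.card {x : Fin n → X // Multiset.map x Finset.univ.val = M} *
      ∏ a ∈ M.toFinset, (M.count a).factorial = n.factorial := by
  induction n generalizing M with
  | zero =>
    obtain rfl := Multiset.card_eq_zero.1 hM
    simp
  | succ n ih =>
    have key (a : M.toFinset) := ih (M.erase a) (by
      rw [Multiset.card_erase_of_mem (Multiset.mem_toFinset.1 a.2), hM, Nat.pred_succ])
    have hfin (a : M.toFinset) :
        Finite {x : Fin n → X // Multiset.map x Finset.univ.val = M.erase a} :=
      Nat.finite_of_card_ne_zero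
        (left_ne_zero_of_mul ((key a).trans_ne (Nat.factorial_ne_zero n)))
    rw [Nat.card_congr (tupleConsEquiv n M), Nat.card_sigma, Finset.sum_mul]
    have hterm (a : M.toFinset) :
        Nat.card {x : Fin n → X // Multiset.map x Finset.univ.val = M.erase a} *
          ∏ b ∈ M.toFinset, (M.count b).factorial = M.count a.1 * n.factorial := by
      rw [Multiset.prod_factorial_count_erase (Multiset.mem_toFinset.1 a.2), mul_left_comm, key a]
    rw [Finset.sum_congr rfl fun a _ => hterm a, ← Finset.sum_mul,
      Finset.sum_coe_sort M.toFinset (fun a => M.count a), Multiset.toFinset_sum_count_eq, hM,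
      Nat.factorial_succ]

/-- The number of `n`-tuples in `X` whose multiset of coordinates is a given multiset `M`
of size `n` is the multinomial coefficient `n! / ∏ₐ (M.count a)!`. -/
theorem stmt_2 (X : Type*) [DecidableEq X] (n : ℕ) (M : Multiset X)
    (hM : Multiset.card M = n) :
    Nat.card {x : Fin n → X // Multiset.map x Finset.univ.val = M} =
      Nat.multinomial M.toFinset (fun a => M.count a) := by
  refine Nat.eq_of_mul_eq_mul_left
    (Finset.prod_pos fun a (_ : a ∈ M.toFinset) => Nat.factorial_pos (M.count a)) ?_
  rw [Nat.multinomial_spec, Multiset.toFinset_sum_count_eq, hM, mul_comm]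
  exact card_tuples_mul_prod_factorial_count n M hM
end

section
/- Let X be a type with decidable equality, let n be a natural number, let P be a Finpartition of (Finset.univ : Finset (Fin n)), and let M be a multiset over X with Multiset.card M = n. Let λ := Multiset.map Finset.card P.parts.val be the multiset of block sizes of P, and assume that the shape of M equals λ. Then the number of tuples x : Fin n → X such that the multiset of coordinates of x equals M and such that for all i j : Fin n one has x i = x j if and only if i and j lie in the same part of P, equals ∏_{s ∈ λ.toFinset} (λ.count s)! (the order of the symmetry group of the shape λ). -/
/-- The number of coordinates of a tuple equal to `a` is the multiplicity of `a` in its multiset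
of coordinates. -/
theorem count_map_univ {κ X : Type*} [Fintype κ] [DecidableEq X] (x : κ → X) (a : X) :
    (Multiset.map x Finset.univ.val).count a = (Finset.univ.filter fun i => x i = a).card := by
  rw [Multiset.count_map, Finset.card_def, Finset.filter_val]
  simp only [eq_comm]

/-- Two finite families of values with the same multiset of values agree up to a bijection of their
index types. -/
theorem exists_equiv_comp_eq_of_map_univ_eq {α β ι : Type*} [Fintype α] [Fintype β]
    {f : α → ι} {g : β → ι}
    (h : Multiset.map f Finset.univ.val = Multiset.map g Finset.univ.val) :
    ∃ e : α ≃ β, g ∘ e = f := by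
  classical
  have hfib (s : ι) : Nonempty ({a // f a = s} ≃ {b // g b = s}) := by
    rw [← Fintype.card_eq, Fintype.card_subtype, Fintype.card_subtype]
    simpa only [count_map_univ] using congrArg (Multiset.count s) h
  exact ⟨Equiv.ofFiberEquiv fun s => (hfib s).some, funext (Equiv.ofFiberEquiv_map _)⟩

/-- The number of bijections matching two finite families with the same multiset of values. -/
theorem card_equiv_comp_eq {α β ι : Type*} [Fintype α] [Fintype β] [DecidableEq ι]
    {f : α → ι} {g : β → ι}
    (h : Multiset.map f Finset.univ.val = Multiset.map g Finset.univ.val) :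
    Nat.card {e : α ≃ β // g ∘ e = f} =
      ∏ s ∈ (Multiset.map f Finset.univ.val).toFinset,
        ((Multiset.map f Finset.univ.val).count s).factorial := by
  classical
  obtain ⟨e₀, rfl⟩ := exists_equiv_comp_eq_of_map_univ_eq h
  have hcongr : {e : α ≃ β // g ∘ e = g ∘ e₀} ≃
      {σ : Equiv.Perm α // (g ∘ e₀) ∘ σ = g ∘ e₀} :=
    Equiv.subtypeEquiv (Equiv.equivCongr (Equiv.refl α) e₀.symm) fun e => by
      simp [funext_iff]
  rw [Nat.card_congr hcongr, Nat.card_eq_fintype_card, DomMulAct.stabilizer_card']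
  refine Finset.prod_congr rfl fun s _ => ?_
  rw [count_map_univ, Fintype.card_subtype]

/-- Tuples with coordinate multiset `M` and coincidence pattern `P` correspond to the bijections
from the parts of `P` to the distinct elements of `M` that match sizes with multiplicities. -/
theorem card_tuples_eq_card_equiv {κ X : Type*} [Fintype κ] [DecidableEq κ] [DecidableEq X]
    (P : Finpartition (Finset.univ : Finset κ)) (M : Multiset X) :
    Nat.card {x : κ → X // Multiset.map x Finset.univ.val = M ∧
        ∀ i j : κ, x i = x j ↔ ∃ B ∈ P.parts, i ∈ B ∧ j ∈ B} =
      Nat.card {e : P.parts ≃ M.toFinset //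
        (fun a : M.toFinset => M.count a.1) ∘ e = fun B : P.parts => B.1.card} := by
  have hpart (i : κ) : P.part i ∈ P.parts := P.part_mem.2 (Finset.mem_univ i)
  have hmem (B : P.parts) (i : κ) : (⟨P.part i, hpart i⟩ : P.parts) = B ↔ i ∈ B.1 := by
    rw [Subtype.ext_iff, P.part_eq_iff_mem B.2]
  have hne (B : P.parts) : ∃ i, i ∈ B.1 := P.nonempty_of_mem_parts B.2
  symm
  refine Nat.card_congr (Equiv.ofBijective (fun e => ⟨fun i => e.1 ⟨P.part i, hpart i⟩, ?_, ?_⟩)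
    ⟨?_, ?_⟩)
  · ext a
    rw [count_map_univ]
    by_cases ha : a ∈ M.toFinset
    · have hcount := congrFun e.2 (e.1.symm ⟨a, ha⟩)
      simp only [Function.comp_apply, Equiv.apply_symm_apply] at hcount
      rw [hcount]
      congr 1
      ext i
      rw [Finset.mem_filter_univ, ← hmem, Equiv.eq_symm_apply, Subtype.ext_iff]
    · rw [Multiset.count_eq_zero_of_notMem (by simpa using ha), Finset.card_eq_zero,
        Finset.filter_eq_empty_iff]
      rintro i - rfl
      exact ha (Subtype.prop _)
  · intro i j
    rw [← Subtype.ext_iff, e.1.apply_eq_iff_eq, hmem, Finpartition.mem_part_iff_exists]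
  · rintro ⟨e, he⟩ ⟨e', he'⟩ h
    simp only [Subtype.mk.injEq] at h ⊢
    ext B
    obtain ⟨i, hi⟩ := hne B
    simpa [(hmem B i).2 hi] using congrFun h i
  · rintro ⟨x, hxM, hx⟩
    choose r hr using hne
    have hxr (B : P.parts) (i : κ) : x i = x (r B) ↔ i ∈ B.1 := by
      rw [hx, ← P.mem_part_iff_exists, P.part_eq_of_mem B.2 (hr B)]
    have hxmem (i : κ) : x i ∈ M.toFinset := by simp [← hxM]
    let φ : P.parts → M.toFinset := fun B => ⟨x (r B), hxmem _⟩
    have hφ : Function.Bijective φ := by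
      constructor
      · intro B C h
        rw [← (hmem B (r B)).2 (hr B), hmem, ← hxr]
        exact Subtype.ext_iff.1 h
      · rintro ⟨a, ha⟩
        obtain ⟨i, rfl⟩ : ∃ i, x i = a := by simpa [← hxM] using ha
        refine ⟨⟨P.part i, hpart i⟩, Subtype.ext ?_⟩
        exact ((hxr ⟨P.part i, hpart i⟩ i).2 (P.mem_part (Finset.mem_univ i))).symm
    refine ⟨⟨Equiv.ofBijective φ hφ, ?_⟩, Subtype.ext ?_⟩
    · funext B
      simp only [Function.comp_apply, Equiv.ofBijective_apply, φ, ← hxM, count_map_univ, hxr]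
      simp
    · funext i
      exact ((hxr ⟨P.part i, hpart i⟩ i).2 (P.mem_part (Finset.mem_univ i))).symm


/-- Given a multiset `M` of size `n` and a set partition `P` of `Fin n` whose multiset of
block sizes `lam` equals the shape of `M`, the number of tuples `x : Fin n → X` with
coordinate multiset `M` and coincidence pattern exactly `P` is `∏ₛ (lam.count s)!`,
the order of the symmetry group of the shape `lam`. -/
theorem stmt_3 (X : Type*) [DecidableEq X] (n : ℕ)
    (P : Finpartition (Finset.univ : Finset (Fin n))) (M : Multiset X)
    (hM : Multiset.card M = n) (lam : Multiset ℕ)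
    (hlam : lam = Multiset.map Finset.card P.parts.val)
    (hshape : Multiset.map (fun a => M.count a) M.toFinset.val = lam) :
    Nat.card {x : Fin n → X // Multiset.map x Finset.univ.val = M ∧
        ∀ i j : Fin n, x i = x j ↔ ∃ B ∈ P.parts, i ∈ B ∧ j ∈ B} =
      ∏ s ∈ lam.toFinset, (lam.count s).factorial := by
  subst hlam
  have hparts : Multiset.map (fun B : P.parts => B.1.card) Finset.univ.val =
      Multiset.map Finset.card P.parts.val :=
    Multiset.attach_map_val' P.parts.val Finset.card
  have hcounts : Multiset.map (fun a : M.toFinset => M.count a.1) Finset.univ.val =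
      Multiset.map (fun a => M.count a) M.toFinset.val :=
    Multiset.attach_map_val' M.toFinset.val fun a => M.count a
  rw [card_tuples_eq_card_equiv, card_equiv_comp_eq (hparts.trans (hcounts.trans hshape).symm),
    hparts]
end

section
/- Let n be a natural number and let λ be a multiset of natural numbers with every entry positive and λ.sum = n. Let N be the number of Finpartitions P of (Finset.univ : Finset (Fin n)) whose multiset of block sizes Multiset.map Finset.card P.parts.val equals λ. Then N · (∏_{s ∈ λ.toFinset} (λ.count s)!) · (Multiset.map Nat.factorial λ).prod = n!. Equivalently, the number of set partitions of an n-element set with shape λ is (1/|Sym_λ|)·n!/∏ λᵢ!, where |Sym_λ| = ∏_{s} (λ.count s)!. -/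
/-- The families of pairwise disjoint finsets with union `s` whose multiset of cardinalities
is `m`. -/
noncomputable def disjointFamilies {α : Type*} [Fintype α] [DecidableEq α] (s : Finset α) (m : Multiset ℕ) :
    Finset (Finset (Finset α)) :=
  open Classical in
  {F | (F : Set (Finset α)).PairwiseDisjoint id ∧ F.sup id = s ∧ F.val.map Finset.card = m}

theorem mem_disjointFamilies {α : Type*} [Fintype α] [DecidableEq α] {s : Finset α}
    {m : Multiset ℕ} {F : Finset (Finset α)} :
    F ∈ disjointFamilies s m ↔ (F : Set (Finset α)).PairwiseDisjoint id ∧ F.sup id = s ∧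
      F.val.map Finset.card = m := by
  simp [disjointFamilies]

theorem erase_mem_disjointFamilies {α : Type*} [Fintype α] [DecidableEq α] {s B : Finset α}
    {m : Multiset ℕ} {F : Finset (Finset α)} (hF : F ∈ disjointFamilies s (B.card ::ₘ m))
    (hB : B ∈ F) : F.erase B ∈ disjointFamilies (s \ B) m := by
  rw [mem_disjointFamilies] at hF ⊢
  obtain ⟨hd, hs, hm⟩ := hF
  refine ⟨hd.subset (by simp), ?_, ?_⟩
  · subst hs
    ext x
    simp only [Finset.mem_sup, Finset.mem_erase, id, Finset.mem_sdiff]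
    constructor
    · rintro ⟨C, ⟨hCB, hC⟩, hx⟩
      exact ⟨⟨C, hC, hx⟩, Finset.disjoint_left.1 (hd hC hB hCB) hx⟩
    · rintro ⟨⟨C, hC, hx⟩, hxB⟩
      exact ⟨C, ⟨fun h => hxB (h ▸ hx), hC⟩, hx⟩
  · rw [Finset.erase_val, Multiset.map_erase_of_mem _ _ hB, hm, Multiset.erase_cons_head]

theorem notMem_of_mem_disjointFamilies_sdiff {α : Type*} [Fintype α] [DecidableEq α]
    {s B : Finset α} {m : Multiset ℕ} {G : Finset (Finset α)}
    (hG : G ∈ disjointFamilies (s \ B) m) (hB : 0 < B.card) : B ∉ G := by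
  intro h
  obtain ⟨x, hx⟩ := Finset.card_pos.1 hB
  have hsub : B ⊆ s \ B := (mem_disjointFamilies.1 hG).2.1 ▸ Finset.le_sup (f := id) h
  exact (Finset.mem_sdiff.1 (hsub hx)).2 hx

theorem insert_mem_disjointFamilies {α : Type*} [Fintype α] [DecidableEq α] {s B : Finset α}
    {m : Multiset ℕ} {G : Finset (Finset α)} (hG : G ∈ disjointFamilies (s \ B) m)
    (hBs : B ⊆ s) (hB : 0 < B.card) : insert B G ∈ disjointFamilies s (B.card ::ₘ m) := by
  have hBG := notMem_of_mem_disjointFamilies_sdiff hG hB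
  rw [mem_disjointFamilies] at hG ⊢
  obtain ⟨hd, hs, hm⟩ := hG
  refine ⟨?_, ?_, ?_⟩
  · rw [Finset.coe_insert]
    refine hd.insert fun C hC _ => ?_
    have hsub : C ⊆ s \ B := hs ▸ Finset.le_sup (f := id) hC
    exact Finset.disjoint_sdiff.mono_right hsub
  · rw [Finset.sup_insert, hs]
    exact Finset.union_sdiff_of_subset hBs
  · rw [Finset.insert_val_of_notMem hBG, Multiset.map_cons, hm]

/-- Double counting of the families with shape `a ::ₘ m` and a marked member of size `a`. -/
theorem card_disjointFamilies_cons_mul {α : Type*} [Fintype α] [DecidableEq α] (s : Finset α)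
    {a : ℕ} (ha : 0 < a) (m : Multiset ℕ) :
    (disjointFamilies s (a ::ₘ m)).card * (m.count a + 1) =
      ∑ B ∈ s.powersetCard a, (disjointFamilies (s \ B) m).card := by
  have hmark : ∀ F ∈ disjointFamilies s (a ::ₘ m),
      (F.filter fun B => B.card = a).card = m.count a + 1 := by
    intro F hF
    rw [← Multiset.count_cons_self, ← (mem_disjointFamilies.1 hF).2.2, Multiset.count_map]
    simp only [eq_comm (a := a), ← Finset.filter_val, Finset.card_val]
  rw [← smul_eq_mul, ← Finset.sum_const, ← Finset.sum_congr rfl hmark, ← Finset.card_sigma,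
    ← Finset.card_sigma]
  refine Finset.card_bij' (fun x _ => ⟨x.2, x.1.erase x.2⟩) (fun y _ => ⟨insert y.1 y.2, y.1⟩)
    ?_ ?_ ?_ ?_
  · rintro ⟨F, B⟩ h
    simp only [Finset.mem_sigma, Finset.mem_filter, Finset.mem_powersetCard] at h ⊢
    obtain ⟨hF, hB, rfl⟩ := h
    exact ⟨⟨(mem_disjointFamilies.1 hF).2.1 ▸ Finset.le_sup (f := id) hB, rfl⟩,
      erase_mem_disjointFamilies hF hB⟩
  · rintro ⟨B, G⟩ h
    simp only [Finset.mem_sigma, Finset.mem_filter, Finset.mem_powersetCard] at h ⊢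
    obtain ⟨⟨hBs, rfl⟩, hG⟩ := h
    exact ⟨insert_mem_disjointFamilies hG hBs ha, Finset.mem_insert_self _ _, rfl⟩
  · rintro ⟨F, B⟩ h
    simp only [Finset.mem_sigma, Finset.mem_filter] at h
    simp [Finset.insert_erase h.2.1]
  · rintro ⟨B, G⟩ h
    simp only [Finset.mem_sigma, Finset.mem_powersetCard] at h
    obtain ⟨⟨hBs, rfl⟩, hG⟩ := h
    simp [Finset.erase_insert (notMem_of_mem_disjointFamilies_sdiff hG ha)]

theorem prod_factorial_count_cons {α : Type*} [DecidableEq α] (a : α) (m : Multiset α) :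
    ∏ s ∈ (a ::ₘ m).toFinset, ((a ::ₘ m).count s).factorial =
      (m.count a + 1) * ∏ s ∈ m.toFinset, (m.count s).factorial := by
  have hm : ∏ s ∈ m.toFinset, (m.count s).factorial =
      ∏ s ∈ (a ::ₘ m).toFinset, (m.count s).factorial := by
    refine Finset.prod_subset (by simp) fun x _ hx => ?_
    rw [Multiset.count_eq_zero_of_notMem (by simpa using hx), Nat.factorial_zero]
  have ha : a ∈ (a ::ₘ m).toFinset := by simp
  rw [hm, ← Finset.mul_prod_erase _ _ ha, ← Finset.mul_prod_erase _ _ ha,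
    Multiset.count_cons_self, Nat.factorial_succ, mul_assoc]
  congr 2
  refine Finset.prod_congr rfl fun x hx => ?_
  rw [Multiset.count_cons_of_ne (Finset.ne_of_mem_erase hx)]

theorem card_disjointFamilies_mul {α : Type*} [Fintype α] [DecidableEq α] (m : Multiset ℕ)
    (hpos : ∀ k ∈ m, 0 < k) (s : Finset α) (hsum : m.sum = s.card) :
    (disjointFamilies s m).card * (∏ k ∈ m.toFinset, (m.count k).factorial) *
      (m.map Nat.factorial).prod = s.card.factorial := by
  induction m using Multiset.induction generalizing s with
  | empty =>
    obtain rfl : s = ∅ := by simpa [eq_comm] using hsum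
    have : disjointFamilies (∅ : Finset α) 0 = {∅} := by
      ext F
      rw [mem_disjointFamilies, Multiset.map_eq_zero, Finset.val_eq_zero, Finset.mem_singleton]
      exact ⟨fun h => h.2.2, by rintro rfl; simp⟩
    simp [this]
  | cons a m ih =>
    rw [Multiset.sum_cons] at hsum
    have hcard : ∀ B ∈ s.powersetCard a, (disjointFamilies (s \ B) m).card *
        ((∏ k ∈ m.toFinset, (m.count k).factorial) * (m.map Nat.factorial).prod) =
          (s.card - a).factorial := by
      intro B hB
      obtain ⟨hBs, rfl⟩ := Finset.mem_powersetCard.1 hB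
      rw [← mul_assoc, ih (fun k hk => hpos k (Multiset.mem_cons_of_mem hk)),
        Finset.card_sdiff_of_subset hBs]
      rw [Finset.card_sdiff_of_subset hBs]
      omega
    rw [prod_factorial_count_cons, Multiset.map_cons, Multiset.prod_cons]
    calc _ = (disjointFamilies s (a ::ₘ m)).card * (m.count a + 1) *
          ((∏ k ∈ m.toFinset, (m.count k).factorial) * (m.map Nat.factorial).prod) *
            a.factorial := by ring
      _ = s.card.choose a * a.factorial * (s.card - a).factorial := by
        rw [card_disjointFamilies_cons_mul s (hpos a (Multiset.mem_cons_self a m)),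
          Finset.sum_mul, Finset.sum_congr rfl hcard, Finset.sum_const,
          Finset.card_powersetCard, smul_eq_mul]
        ring
      _ = s.card.factorial := Nat.choose_mul_factorial_mul_factorial (by omega)

theorem card_finpartition_eq_card_disjointFamilies {α : Type*} [Fintype α] [DecidableEq α]
    (s : Finset α) {m : Multiset ℕ} (hpos : ∀ k ∈ m, 0 < k) :
    Nat.card {P : Finpartition s // Multiset.map Finset.card P.parts.val = m} =
      (disjointFamilies s m).card := by
  rw [← Nat.card_eq_finsetCard]
  refine Nat.card_congr
    { toFun := fun P => ⟨P.1.parts, mem_disjointFamilies.2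
        ⟨P.1.supIndep.pairwiseDisjoint, P.1.sup_parts, P.2⟩⟩
      invFun := fun F =>
        have hF := mem_disjointFamilies.1 F.2
        ⟨{ parts := F.1
           supIndep := Finset.supIndep_iff_pairwiseDisjoint.2 hF.1
           sup_parts := hF.2.1
           bot_notMem := fun h =>
            (hpos 0 (hF.2.2 ▸ Multiset.mem_map.2 ⟨∅, h, Finset.card_empty⟩)).false }, hF.2.2⟩
      left_inv := fun _ => rfl
      right_inv := fun _ => rfl }

/-- The number `N` of set partitions of `Fin n` with shape `lam` satisfies
`N · ∏ₛ (lam.count s)! · ∏ᵢ λᵢ! = n!`. -/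
theorem stmt_4 (n : ℕ) (lam : Multiset ℕ) (hpos : ∀ s ∈ lam, 0 < s)
    (hsum : lam.sum = n) :
    Nat.card {P : Finpartition (Finset.univ : Finset (Fin n)) //
          Multiset.map Finset.card P.parts.val = lam} *
        (∏ s ∈ lam.toFinset, (lam.count s).factorial) *
        (Multiset.map Nat.factorial lam).prod =
      n.factorial := by
  rw [card_finpartition_eq_card_disjointFamilies _ hpos,
    card_disjointFamilies_mul lam hpos _ (by simpa using hsum), Finset.card_fin]
end

section
/- Let X be a metric space in which no point is isolated (for every x ∈ X the punctured neighborhood filter 𝓝[≠] x is nontrivial, i.e. x is an accumulation point of X), let n be a natural number, and let ∼ be an equivalence relation (Setoid) on Fin n. In the product space Fin n → X, the closure of the stratum {x : Fin n → X | ∀ i j, x i = x j ↔ i ∼ j} equals the subspace {x : Fin n → X | ∀ i j, i ∼ j → x i = x j}. In particular, taking ∼ to be equality on Fin n, the set of injective tuples {x : Fin n → X | Function.Injective x} is dense in Fin n → X. -/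
open Topology

theorem dense_biInter_finset_of_isOpen {Y κ : Type*} [TopologicalSpace Y] (s : Finset κ)
    {U : κ → Set Y} (ho : ∀ k ∈ s, IsOpen (U k)) (hd : ∀ k ∈ s, Dense (U k)) :
    Dense (⋂ k ∈ s, U k) := by
  classical
  induction s using Finset.induction_on with
  | empty => simp
  | insert a s _ ih =>
    rw [Finset.set_biInter_insert]
    exact (hd a (by simp)).inter_of_isOpen_left
      (ih (fun k hk => ho k (by simp [hk])) fun k hk => hd k (by simp [hk])) (ho a (by simp))

theorem dense_setOf_apply_ne {X ι : Type*} [TopologicalSpace X] (hX : ∀ x : X, (𝓝[≠] x).NeBot)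
    {i j : ι} (hij : i ≠ j) : Dense {x : ι → X | x i ≠ x j} := by
  classical
  intro x
  by_cases h : x i = x j
  · have := hX (x i)
    have hc : Filter.Tendsto (fun t => Function.update x i t) (𝓝[≠] (x i)) (𝓝 x) := by
      have hu : Continuous fun t => Function.update x i t := by fun_prop
      simpa using (hu.tendsto (x i)).mono_left nhdsWithin_le_nhds
    refine mem_closure_of_tendsto hc ?_
    filter_upwards [self_mem_nhdsWithin] with t ht
    simpa [Function.update_of_ne hij.symm, ← h] using ht
  · exact subset_closure h

theorem dense_setOf_injective {X ι : Type*} [TopologicalSpace X] [T2Space X] [Finite ι]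
    (hX : ∀ x : X, (𝓝[≠] x).NeBot) : Dense {x : ι → X | Function.Injective x} := by
  classical
  have := Fintype.ofFinite ι
  refine (dense_biInter_finset_of_isOpen (Finset.univ.filter fun p : ι × ι => p.1 ≠ p.2)
    (U := fun p => {x : ι → X | x p.1 ≠ x p.2})
    (fun p _ => isOpen_ne_fun (continuous_apply _) (continuous_apply _))
    fun p hp => dense_setOf_apply_ne hX (Finset.mem_filter.1 hp).2).mono ?_
  intro x hx i j hij
  by_contra h
  exact Set.mem_iInter₂.1 hx (i, j) (by simpa using h) hij

/-- In a metric space with no isolated points, the closure of the stratum of tuples whose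
coincidence pattern is exactly a given equivalence relation `r` is the subspace of tuples
whose coordinates merely agree on `r`-equivalent indices.  In particular (taking `r` to
be equality) the injective tuples are dense in `Fin n → X`. -/
theorem stmt_5 (X : Type*) [MetricSpace X] (hX : ∀ x : X, (nhdsWithin x {x}ᶜ).NeBot)
    (n : ℕ) (r : Setoid (Fin n)) :
    closure {x : Fin n → X | ∀ i j, x i = x j ↔ r i j} =
        {x : Fin n → X | ∀ i j, r i j → x i = x j} ∧
      Dense {x : Fin n → X | Function.Injective x} := by
  refine ⟨Set.Subset.antisymm ?_ ?_, dense_setOf_injective hX⟩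
  · refine closure_minimal (fun x hx i j h => (hx i j).2 h) ?_
    simp only [Set.ofPred_forall]
    exact isClosed_iInter fun i => isClosed_iInter fun j => isClosed_iInter fun _ =>
      isClosed_eq (continuous_apply i) (continuous_apply j)
  · intro x hx
    have hc : Continuous fun (y : Quotient r → X) (i : Fin n) => y (Quotient.mk r i) := by
      fun_prop
    refine map_mem_closure hc (dense_setOf_injective hX (Quotient.lift x hx)) ?_
    intro y hy i j
    exact hy.eq_iff.trans Quotient.eq
end

section
/- Let n be a natural number and let Q be the quotient of the product space Fin n → ℂ by the setoid in which x ≈ y if and only if there exists σ : Equiv.Perm (Fin n) with x = y ∘ σ (the coordinate-permuting action of the symmetric group), with Q carrying the quotient topology. Then for every continuous map α : Set.Icc (0:ℝ) 1 → Q and every x₀ : Fin n → ℂ whose class in Q equals α 0, there exists a continuous map β : Set.Icc (0:ℝ) 1 → (Fin n → ℂ) with β 0 = x₀ and with the class of β t in Q equal to α t for every t. (Every path of n-element multisets of complex numbers lifts, with any prescribed lift of its start point, to a path of n-tuples.) -/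
/-- The setoid on `Fin n → ℂ` identifying tuples that differ by a coordinate permutation;
the quotient is the space `Mult_n(ℂ)` of `n`-element multisets of complex numbers. -/
def permSetoid (n : ℕ) : Setoid (Fin n → ℂ) where
  r x y := ∃ σ : Equiv.Perm (Fin n), x = y ∘ σ
  iseqv := by
    constructor
    · intro x
      exact ⟨Equiv.refl _, rfl⟩
    · rintro x y ⟨σ, rfl⟩
      exact ⟨σ⁻¹, by funext i; simp⟩
    · rintro x y z ⟨σ, rfl⟩ ⟨τ, rfl⟩
      exact ⟨σ.trans τ, rfl⟩

/-- A real function on a finite chain whose jumps between neighbours are at most `2 * ω` and whose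
values are within `ω` of a finite family cannot increase by more than `6 * ω` times the size of
the family. -/
theorem sub_le_of_chain {T ι : Type*} [LinearOrder T] [Fintype ι] (S : Finset T) {s t : T}
    (hs : s ∈ S) (hst : s ≤ t) (f : T → ℝ) (F : ι → ℝ) {ω : ℝ} (hω : 0 ≤ ω)
    (near : ∀ u ∈ S, s ≤ u → u ≤ t → ∃ j, |f u - F j| ≤ ω) (ht : t ∈ S)
    (jump : ∀ u ∈ S, ∀ v ∈ S, s ≤ u → u < v → v ≤ t → (∀ w ∈ S, ¬(u < w ∧ w < v)) →
      f v - f u ≤ 2 * ω) :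
    f t - f s ≤ Fintype.card ι * (6 * ω) := by
  have cover : Set.Icc (f s) (f t) ⊆ ⋃ j, Metric.closedBall (F j) (3 * ω) := by
    rintro r ⟨hr₁, hr₂⟩
    obtain ⟨u, hu, hmax⟩ := (S.filter fun u ↦ s ≤ u ∧ u ≤ t ∧ f u ≤ r).exists_max_image id
      ⟨s, by simp [hs, hst, hr₁]⟩
    simp only [Finset.mem_filter, id] at hu hmax
    obtain ⟨huS, hsu, hut, hur⟩ := hu
    obtain ⟨j, hj⟩ := near u huS hsu hut
    have hru : r - f u ≤ 2 * ω := by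
      rcases hut.eq_or_lt with rfl | hlt
      · linarith
      obtain ⟨v, hv, hmin⟩ := (S.filter fun v ↦ u < v ∧ v ≤ t).exists_min_image id
        ⟨t, by simp [ht, hlt]⟩
      simp only [Finset.mem_filter, id] at hv hmin
      obtain ⟨hvS, huv, hvt⟩ := hv
      have hrv : r < f v := by
        by_contra! h
        exact (hmax v ⟨hvS, hsu.trans huv.le, hvt, h⟩).not_gt huv
      have := jump u huS v hvS hsu huv hvt fun w hw ⟨h₁, h₂⟩ ↦
        (hmin w ⟨hw, h₁, h₂.le.trans hvt⟩).not_gt h₂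
      linarith
    refine Set.mem_iUnion.2 ⟨j, ?_⟩
    rw [Metric.mem_closedBall, Real.dist_eq, abs_le]
    rw [abs_le] at hj
    constructor <;> linarith [hj.1, hj.2]
  have hvol := (MeasureTheory.measure_mono (μ := MeasureTheory.volume) cover).trans
    (MeasureTheory.measure_iUnion_fintype_le _ _)
  simp only [Real.volume_Icc, Real.volume_closedBall, Finset.sum_const, Finset.card_univ,
    nsmul_eq_mul] at hvol
  rw [← ENNReal.ofReal_natCast, ← ENNReal.ofReal_mul (by positivity),
    ENNReal.ofReal_le_ofReal_iff (by positivity)] at hvol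
  linarith

/-- Over a finite set of times, tuples can be relabelled so that each one is optimally matched
with its predecessor. -/
theorem exists_perm_consecutive_dist_le {T ι X : Type*} [LinearOrder T] [Fintype ι]
    [PseudoMetricSpace X] (a : T → ι → X) (S : Finset T) :
    ∃ σ : T → Equiv.Perm ι, ∀ u ∈ S, ∀ v ∈ S, u < v → (∀ w ∈ S, ¬(u < w ∧ w < v)) →
      ∀ τ : Equiv.Perm ι, dist (a u ∘ σ u) (a v ∘ σ v) ≤ dist (a u ∘ σ u) (a v ∘ τ) := by
  classical
  induction S using Finset.induction_on_max with
  | empty => exact ⟨fun _ ↦ 1, by simp⟩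
  | insert m S hm ih =>
    obtain ⟨σ, hσ⟩ := ih
    rcases S.eq_empty_or_nonempty with rfl | hS
    · refine ⟨σ, fun u hu v hv huv ↦ ?_⟩
      simp only [insert_empty_eq, Finset.mem_singleton] at hu hv
      exact absurd huv (by simp [hu, hv])
    obtain ⟨ρ, hρ⟩ := Finite.exists_min
      fun τ : Equiv.Perm ι ↦ dist (a (S.max' hS) ∘ σ (S.max' hS)) (a m ∘ τ)
    refine ⟨Function.update σ m ρ, fun u hu v hv huv hcons τ ↦ ?_⟩
    have hum : u ≠ m := by
      rintro rfl
      rcases Finset.mem_insert.1 hv with rfl | hv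
      · exact huv.false
      · exact (hm v hv).not_gt huv
    have huS : u ∈ S := (Finset.mem_insert.1 hu).resolve_left hum
    rcases Finset.mem_insert.1 hv with rfl | hvS
    · have hmax : u = S.max' hS := by
        refine le_antisymm (S.le_max' u huS) (not_lt.1 fun h ↦ ?_)
        exact hcons _ (Finset.mem_insert_of_mem (S.max'_mem hS)) ⟨h, hm _ (S.max'_mem hS)⟩
      rw [Function.update_self, Function.update_of_ne hum, hmax]
      exact hρ τ
    · rw [Function.update_of_ne hum, Function.update_of_ne (hm v hvS).ne]
      exact hσ u huS v hvS huv (fun w hw ↦ hcons w (Finset.mem_insert_of_mem hw)) τ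

/-- The tuples `x` and `y` at times `s` and `t` are close whenever all unordered tuples of the
family `a` between these times are close to a common one. -/
def HasOscBound {T ι X : Type*} [LinearOrder T] [Fintype ι] [PseudoMetricSpace X]
    (a : T → ι → X) (s t : T) (x y : ι → X) : Prop :=
  ∀ (z : ι → X) (ω : ℝ), (∀ u ∈ Set.Icc s t, ∃ τ : Equiv.Perm ι, dist z (a u ∘ τ) ≤ ω) →
    dist x y ≤ Fintype.card ι * (6 * ω)

theorem exists_perm_hasOscBound_finset {T ι X : Type*} [LinearOrder T] [Fintype ι]
    [PseudoMetricSpace X] (a : T → ι → X) (S : Finset T) :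
    ∃ σ : T → Equiv.Perm ι, ∀ s ∈ S, ∀ t ∈ S, s ≤ t →
      HasOscBound a s t (a s ∘ σ s) (a t ∘ σ t) := by
  obtain ⟨σ, hσ⟩ := exists_perm_consecutive_dist_le a S
  refine ⟨σ, fun s hs t ht hst z ω hz ↦ ?_⟩
  have hω : 0 ≤ ω := by
    obtain ⟨τ, hτ⟩ := hz s ⟨le_rfl, hst⟩
    exact dist_nonneg.trans hτ
  refine (dist_pi_le_iff (by positivity)).2 fun i ↦ ?_
  have := sub_le_of_chain S hs hst (fun u ↦ dist (a s (σ s i)) (a u (σ u i)))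
    (fun j ↦ dist (a s (σ s i)) (z j)) hω ?_ ht ?_
  · simpa using this
  · intro u _ hsu hut
    obtain ⟨τ, hτ⟩ := hz u ⟨hsu, hut⟩
    refine ⟨τ.symm (σ u i), ?_⟩
    have h := (dist_le_pi_dist z (a u ∘ τ) (τ.symm (σ u i))).trans hτ
    simp only [Function.comp_apply, Equiv.apply_symm_apply] at h
    rw [dist_comm] at h
    have h' := abs_dist_sub_le (a u (σ u i)) (z (τ.symm (σ u i))) (a s (σ s i))
    rw [dist_comm _ (a s (σ s i)), dist_comm _ (a s (σ s i))] at h'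
    exact h'.trans h
  · intro u hu v hv hsu huv hvt hcons
    obtain ⟨τ, hτ⟩ := hz u ⟨hsu, huv.le.trans hvt⟩
    obtain ⟨ρ, hρ⟩ := hz v ⟨hsu.trans huv.le, hvt⟩
    have hmatch : dist (a u ∘ σ u) (a v ∘ ((σ u).trans (τ.symm.trans ρ))) ≤ 2 * ω := by
      refine (dist_pi_le_iff (by positivity)).2 fun k ↦ ?_
      have h₁ := (dist_le_pi_dist z (a u ∘ τ) (τ.symm (σ u k))).trans hτ
      have h₂ := (dist_le_pi_dist z (a v ∘ ρ) (τ.symm (σ u k))).trans hρ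
      simp only [Function.comp_apply, Equiv.apply_symm_apply] at h₁ h₂
      simp only [Function.comp_apply, Equiv.trans_apply]
      linarith [dist_triangle_left (a u (σ u k)) (a v (ρ (τ.symm (σ u k)))) (z (τ.symm (σ u k)))]
    have h := (dist_le_pi_dist _ _ i).trans ((hσ u hu v hv huv hcons _).trans hmatch)
    simp only [Function.comp_apply] at h
    linarith [dist_triangle (a s (σ s i)) (a u (σ u i)) (a v (σ v i))]

theorem exists_perm_hasOscBound {T ι X : Type*} [LinearOrder T] [Fintype ι]
    [PseudoMetricSpace X] (a : T → ι → X) :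
    ∃ σ : T → Equiv.Perm ι, ∀ s t, s ≤ t → HasOscBound a s t (a s ∘ σ s) (a t ∘ σ t) := by
  classical
  let _ : TopologicalSpace (Equiv.Perm ι) := ⊥
  have _ : DiscreteTopology (Equiv.Perm ι) := ⟨rfl⟩
  let C : T × T → Set (T → Equiv.Perm ι) := fun p ↦
    {σ | p.1 ≤ p.2 → HasOscBound a p.1 p.2 (a p.1 ∘ σ p.1) (a p.2 ∘ σ p.2)}
  have closed (p : T × T) : IsClosed (C p) := by
    have hcont : Continuous fun σ : T → Equiv.Perm ι ↦ (σ p.1, σ p.2) := by fun_prop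
    exact (isClosed_discrete {q : Equiv.Perm ι × Equiv.Perm ι | p.1 ≤ p.2 →
      HasOscBound a p.1 p.2 (a p.1 ∘ q.1) (a p.2 ∘ q.2)}).preimage hcont
  obtain ⟨σ, -, hσ⟩ := isCompact_univ.inter_iInter_nonempty C closed fun P ↦ by
    obtain ⟨σ, hσ⟩ := exists_perm_hasOscBound_finset a (P.image Prod.fst ∪ P.image Prod.snd)
    refine ⟨σ, Set.mem_univ _, Set.mem_iInter₂.2 fun p hp ↦ hσ _ ?_ _ ?_⟩
    · exact Finset.mem_union_left _ (Finset.mem_image_of_mem _ hp)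
    · exact Finset.mem_union_right _ (Finset.mem_image_of_mem _ hp)
  exact ⟨σ, fun s t ↦ Set.mem_iInter.1 hσ (s, t)⟩

theorem isOpenMap_mk_permSetoid (n : ℕ) : IsOpenMap (Quotient.mk (permSetoid n)) := by
  intro U hU
  have : Quotient.mk (permSetoid n) ⁻¹' (Quotient.mk (permSetoid n) '' U) =
      ⋃ τ : Equiv.Perm (Fin n), (fun x ↦ x ∘ τ) ⁻¹' U := by
    ext x
    simp only [Set.mem_preimage, Set.mem_image, Set.mem_iUnion]
    constructor
    · rintro ⟨y, hy, hyx⟩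
      obtain ⟨τ, rfl⟩ := Quotient.exact hyx
      exact ⟨τ, hy⟩
    · rintro ⟨τ, hτ⟩
      exact ⟨x ∘ τ, hτ, Quotient.sound ⟨τ, rfl⟩⟩
  refine isQuotientMap_quotient_mk'.isOpen_preimage.1 ?_
  change IsOpen (Quotient.mk (permSetoid n) ⁻¹' _)
  rw [this]
  exact isOpen_iUnion fun τ ↦ hU.preimage (by fun_prop)

/-- Every path in the quotient `Mult_n(ℂ) = (Fin n → ℂ)/Sym_n` lifts, with any prescribed
lift of its start point, to a path of `n`-tuples. -/
theorem stmt_6 (n : ℕ) (α : Set.Icc (0:ℝ) 1 → Quotient (permSetoid n))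
    (hα : Continuous α) (x₀ : Fin n → ℂ)
    (hx₀ : Quotient.mk (permSetoid n) x₀ = α ⟨0, by norm_num⟩) :
    ∃ β : Set.Icc (0:ℝ) 1 → (Fin n → ℂ), Continuous β ∧
      β ⟨0, by norm_num⟩ = x₀ ∧
      ∀ t, Quotient.mk (permSetoid n) (β t) = α t := by
  choose a ha using fun t ↦ Quotient.exists_rep (α t)
  obtain ⟨σ, hσ⟩ := exists_perm_hasOscBound a
  have near (t₀ : Set.Icc (0:ℝ) 1) {ω : ℝ} (hω : 0 < ω) :
      ∀ᶠ u in nhds t₀, ∃ τ : Equiv.Perm (Fin n), dist (a t₀) (a u ∘ τ) ≤ ω := by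
    have hmem : Quotient.mk (permSetoid n) '' Metric.ball (a t₀) ω ∈ nhds (α t₀) :=
      (isOpenMap_mk_permSetoid n _ Metric.isOpen_ball).mem_nhds
        ⟨a t₀, Metric.mem_ball_self hω, ha t₀⟩
    filter_upwards [hα.continuousAt hmem] with u hu
    obtain ⟨y, hy, hyu⟩ := hu
    obtain ⟨τ, rfl⟩ := Quotient.exact (hyu.trans (ha u).symm)
    exact ⟨τ, by rw [dist_comm]; exact (Metric.mem_ball.1 hy).le⟩
  have hcont : Continuous fun t ↦ a t ∘ σ t := by
    refine continuous_iff_continuousAt.2 fun t₀ ↦ Metric.tendsto_nhds.2 fun ε hε ↦ ?_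
    have hω : 0 < ε / (6 * n + 1) := by positivity
    have hbound : (Fintype.card (Fin n) : ℝ) * (6 * (ε / (6 * n + 1))) < ε := by
      rw [Fintype.card_fin]
      have : ε = (6 * n + 1) * (ε / (6 * n + 1)) := by field_simp
      linarith
    obtain ⟨δ, hδ, hball⟩ := Metric.eventually_nhds_iff.1 (near t₀ hω)
    refine Metric.eventually_nhds_iff.2 ⟨δ, hδ, fun t ht ↦ lt_of_le_of_lt ?_ hbound⟩
    rw [Subtype.dist_eq, Real.dist_eq, abs_lt] at ht
    rcases le_total t t₀ with h | h
    · refine hσ t t₀ h (a t₀) _ fun u ⟨h₁, h₂⟩ ↦ hball ?_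
      rw [← Subtype.coe_le_coe] at h₁ h₂
      rw [Subtype.dist_eq, Real.dist_eq, abs_lt]
      constructor <;> linarith
    · rw [dist_comm]
      refine hσ t₀ t h (a t₀) _ fun u ⟨h₁, h₂⟩ ↦ hball ?_
      rw [← Subtype.coe_le_coe] at h₁ h₂
      rw [Subtype.dist_eq, Real.dist_eq, abs_lt]
      constructor <;> linarith
  obtain ⟨ρ, hρ⟩ := Quotient.exact (hx₀.trans (ha _).symm)
  let π : Equiv.Perm (Fin n) := ρ.trans (σ ⟨0, by norm_num⟩).symm
  refine ⟨fun t ↦ (a t ∘ σ t) ∘ π, ?_, ?_, fun t ↦ ?_⟩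
  · exact continuous_pi fun i ↦ (continuous_apply (π i)).comp hcont
  · rw [hρ]
    funext i
    simp [π]
  · rw [← ha t]
    exact Quotient.sound ⟨π.trans (σ t), rfl⟩
end

section
/- Let n be a natural number and let β₁, β₂ : Set.Icc (0:ℝ) 1 → (Fin n → ℂ) be continuous maps such that β₁ 0 = β₂ 0, such that for every t the multiset of coordinates of β₁ t equals the multiset of coordinates of β₂ t, and such that the shape of this multiset is weakly increasing in time: for all s ≤ t in Set.Icc (0:ℝ) 1, the shape of the coordinate multiset of β₁ t is a merge of the shape of the coordinate multiset of β₁ s. Then β₁ = β₂. (A multiset path with weakly increasing shape has a unique lift through the Mult map with a given start point.) -/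
/-- The shape of a finite multiset: the multiset of multiplicities of its distinct
elements. -/
noncomputable def mshape {X : Type*} (M : Multiset X) : Multiset ℕ :=
  letI := Classical.decEq X
  Multiset.map (fun a => M.count a) M.toFinset.val

/-- `IsMergeOf μ lam` means `μ` is obtained from `lam` by grouping its entries and
replacing each (nonempty) group by its sum. -/
def IsMergeOf (μ lam : Multiset ℕ) : Prop :=
  ∃ m : Multiset (Multiset ℕ), (∀ s ∈ m, s ≠ 0) ∧ m.join = lam ∧
    Multiset.map Multiset.sum m = μ

open Filter Topology

lemma IsMergeOf.card_le {μ lam : Multiset ℕ} (h : IsMergeOf μ lam) : μ.card ≤ lam.card := by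
  obtain ⟨m, hm, rfl, rfl⟩ := h
  rw [Multiset.card_map, Multiset.card_join]
  have := Multiset.card_nsmul_le_sum (s := m.map Multiset.card) (a := 1) (by
    intro x hx
    obtain ⟨s, hs, rfl⟩ := Multiset.mem_map.1 hx
    exact Multiset.card_pos.2 (hm s hs))
  simpa using this

open Classical in
lemma card_mshape_map_univ {ι X : Type*} [Fintype ι] (x : ι → X) :
    (mshape (Multiset.map x Finset.univ.val)).card = (Finset.univ.image x).card := by
  simp only [mshape, Multiset.card_map, Finset.card_val, Finset.image]

open Classical in
/-- If `y` separates all indices that `x` separates but takes at most as many values as `x`,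
then `y` is constant on the fibres of `x`. -/
lemma eq_of_eq_of_card_image_le {ι X : Type*} [Fintype ι] {x y : ι → X}
    (hsep : ∀ i j, y i = y j → x i = x j)
    (hcard : (Finset.univ.image y).card ≤ (Finset.univ.image x).card)
    {i j : ι} (hij : x i = x j) : y i = y j := by
  obtain ⟨g, hg⟩ : ∃ g : X → X, ∀ k, g (y k) = x k :=
    ⟨fun z => if h : ∃ k, y k = z then x h.choose else z, fun k => by
      have h : ∃ l, y l = y k := ⟨k, rfl⟩
      simpa only [dif_pos h] using hsep _ _ h.choose_spec⟩
  have himage : (Finset.univ.image y).image g = Finset.univ.image x := by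
    rw [Finset.image_image]
    exact Finset.image_congr fun k _ => hg k
  have hinj : Set.InjOn g (Finset.univ.image y) := by
    rw [← Finset.card_image_iff]
    exact le_antisymm Finset.card_image_le (himage ▸ hcard)
  exact hinj (by simp) (by simp) (by rw [hg, hg, hij])

open Classical in
/-- Two families with the same values which agree at `a` agree near `a`, as long as the number
of values does not exceed the one at `a`. -/
lemma eventually_eq_of_card_image_le {ι X T : Type*} [Fintype ι] [TopologicalSpace X] [T2Space X]
    [TopologicalSpace T] {β₁ β₂ : T → ι → X} (h₁ : Continuous β₁) (h₂ : Continuous β₂)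
    (hrange : ∀ t, Set.range (β₁ t) = Set.range (β₂ t)) {a : T} (ha : β₁ a = β₂ a) :
    ∀ᶠ t in 𝓝 a, (Finset.univ.image (β₁ t)).card ≤ (Finset.univ.image (β₁ a)).card →
      β₁ t = β₂ t := by
  have hsep : ∀ γ : T → ι → X, Continuous γ → γ a = β₁ a →
      ∀ᶠ t in 𝓝 a, ∀ i j, β₁ t i = γ t j → β₁ a i = β₁ a j := by
    intro γ hγ hγa
    refine eventually_all.2 fun i => eventually_all.2 fun j => ?_
    by_cases hij : β₁ a i = β₁ a j
    · exact .of_forall fun _ _ => hij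
    · have hne := (isOpen_ne_fun ((continuous_apply i).comp h₁)
        ((continuous_apply j).comp hγ)).mem_nhds (x := a) (by simpa [hγa] using hij)
      filter_upwards [hne] with t ht h using absurd h ht
  filter_upwards [hsep β₁ h₁ rfl, hsep β₂ h₂ ha.symm] with t ht₁ ht₂ hcard
  funext i
  obtain ⟨j, hj⟩ : β₂ t i ∈ Set.range (β₁ t) := hrange t ▸ ⟨i, rfl⟩
  rw [← hj]
  exact (eq_of_eq_of_card_image_le ht₁ hcard (ht₂ j i hj)).symm

/-- A multiset path with weakly increasing shape has a unique lift through the `Mult` map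
with a given start point. -/
theorem stmt_7 (n : ℕ) (β₁ β₂ : Set.Icc (0:ℝ) 1 → (Fin n → ℂ))
    (h₁ : Continuous β₁) (h₂ : Continuous β₂)
    (h0 : β₁ ⟨0, by norm_num⟩ = β₂ ⟨0, by norm_num⟩)
    (hmult : ∀ t, Multiset.map (β₁ t) Finset.univ.val =
      Multiset.map (β₂ t) Finset.univ.val)
    (hinc : ∀ s t : Set.Icc (0:ℝ) 1, s ≤ t →
      IsMergeOf (mshape (Multiset.map (β₁ t) Finset.univ.val))
        (mshape (Multiset.map (β₁ s) Finset.univ.val))) :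
    β₁ = β₂ := by
  classical
  have hrange : ∀ t, Set.range (β₁ t) = Set.range (β₂ t) := fun t => by
    ext z
    simpa using congrArg (z ∈ ·) (hmult t)
  have hcard : ∀ s t, s ≤ t →
      (Finset.univ.image (β₁ t)).card ≤ (Finset.univ.image (β₁ s)).card := fun s t hst => by
    simpa only [card_mshape_map_univ] using (hinc s t hst).card_le
  let p : ℝ → Set.Icc (0:ℝ) 1 := Set.projIcc 0 1 zero_le_one
  have hp : Continuous p := continuous_projIcc
  have hsub : Set.Icc (0:ℝ) 1 ⊆ {t | β₁ (p t) = β₂ (p t)} := by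
    refine IsClosed.Icc_subset_of_forall_mem_nhdsWithin
      ((isClosed_eq (h₁.comp hp) (h₂.comp hp)).inter isClosed_Icc) ?_ ?_
    · simpa [p] using h0
    · rintro a ⟨ha, -⟩
      filter_upwards [nhdsWithin_le_nhds (eventually_eq_of_card_image_le (h₁.comp hp)
        (h₂.comp hp) (fun t => hrange (p t)) ha), self_mem_nhdsWithin] with t ht hat
      exact ht (hcard _ _ (Set.monotone_projIcc _ (le_of_lt hat)))
  funext t
  simpa [p, Set.projIcc_val] using hsub t.2
end

section
/- Let n be a natural number and let β : Set.Icc (0:ℝ) 1 → (Fin n → ℂ) be a continuous map such that the shape of the multiset of coordinates of β t is the same multiset of natural numbers for all t. Then the coincidence pattern of coordinates is constant along the path: for every t and all i, j : Fin n, β t i = β t j if and only if β 0 i = β 0 j. -/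
theorem card_mshape_map {ι X : Type*} [Fintype ι] [DecidableEq X] (f : ι → X) :
    (mshape (Multiset.map f Finset.univ.val)).card = (Finset.univ.image f).card := by
  rw [mshape, Multiset.card_map, Finset.image, ← Finset.card_def]
  congr!

/-- If the fibres of `f` refine those of `g` and both maps take equally many values,
then the fibres of `g` also refine those of `f`. -/
theorem Function.FactorsThrough.symm_of_card_image_eq {ι X : Type*} [Fintype ι] [DecidableEq X]
    {f g : ι → X} (hfg : g.FactorsThrough f)
    (hcard : (Finset.univ.image f).card = (Finset.univ.image g).card) :
    f.FactorsThrough g := by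
  have hcomp : Function.extend f g id ∘ f = g := funext (hfg.extend_apply id)
  rw [← hcomp, ← Finset.image_image] at hcard
  intro i j hij
  refine Finset.card_image_iff.mp hcard.symm (by simp) (by simp) ?_
  rwa [hfg.extend_apply, hfg.extend_apply]

/-- Near any point, a continuous family of tuples creates no new coincidences. -/
theorem Continuous.eventually_factorsThrough {ι X T : Type*} [Finite ι] [TopologicalSpace X]
    [T2Space X] [TopologicalSpace T] {β : T → ι → X} (hβ : Continuous β) (s : T) :
    ∀ᶠ t in nhds s, (β s).FactorsThrough (β t) := by
  have h (i j : ι) : ∀ᶠ t in nhds s, β t i = β t j → β s i = β s j := by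
    by_cases hij : β s i = β s j
    · exact .of_forall fun _ _ => hij
    · have hi := ((continuous_apply i).comp hβ).continuousAt (x := s)
      have hj := ((continuous_apply j).comp hβ).continuousAt (x := s)
      filter_upwards [(hi.ne_iff_eventually_ne hj).mp hij] with t ht h using absurd h ht
  filter_upwards [Filter.eventually_all.mpr fun i => Filter.eventually_all.mpr (h i)]
    with t ht i j using ht i j

/-- Along a path of tuples whose coordinate multiset has constant shape, the coincidence
pattern of the coordinates is constant. -/
theorem stmt_9 (n : ℕ) (β : Set.Icc (0:ℝ) 1 → (Fin n → ℂ)) (hβ : Continuous β)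
    (hshape : ∀ s t : Set.Icc (0:ℝ) 1,
      mshape (Multiset.map (β s) Finset.univ.val) =
        mshape (Multiset.map (β t) Finset.univ.val)) :
    ∀ (t : Set.Icc (0:ℝ) 1) (i j : Fin n),
      β t i = β t j ↔ β ⟨0, by norm_num⟩ i = β ⟨0, by norm_num⟩ j := by
  classical
  have hcard (s t : Set.Icc (0:ℝ) 1) :
      (Finset.univ.image (β s)).card = (Finset.univ.image (β t)).card := by
    rw [← card_mshape_map, ← card_mshape_map, hshape s t]
  have hloc : IsLocallyConstant fun t i j => β t i = β t j := by
    rw [IsLocallyConstant.iff_eventually_eq]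
    intro s
    filter_upwards [hβ.eventually_factorsThrough s] with t ht
    ext i j
    exact ⟨fun h => ht h, fun h => ht.symm_of_card_image_eq (hcard t s) h⟩
  intro t i j
  exact iff_of_eq (congrFun₂ (hloc.apply_eq_of_preconnectedSpace t ⟨0, by norm_num⟩) i j)
end

section
/- Let d ≥ 2 and let a : Set.Icc (0:ℝ) 1 → (Fin (d−1) → ℂ) be continuous, giving a continuous family of monic centered degree-d polynomials p_{a t}. If the shape of the critical value multiset cvl(p_{a t}) is the same multiset of natural numbers for all t, then the shape of the critical point multiset (p_{a t}).derivative.roots is also the same for all t. (A path of polynomials with constant critical value shape has constant critical point shape.) -/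
open Polynomial

/-- The monic centered polynomial `X^d + ∑_{i=0}^{d-2} (a i)·X^i` determined by the
coefficient vector `a`. -/
noncomputable def mcPoly (d : ℕ) (a : Fin (d - 1) → ℂ) : ℂ[X] :=
  X ^ d + ∑ i : Fin (d - 1), C (a i) * X ^ (i : ℕ)

/-- The critical value multiset of a polynomial: the multiset of values of `p` at the
roots (with multiplicity) of its derivative. -/
noncomputable def cvl (p : ℂ[X]) : Multiset ℂ :=
  Multiset.map (fun z => p.eval z) p.derivative.roots

open Filter Topology

/-- If `u` tends to `u₀` and all `u n` take as many distinct values as `u₀`, then eventually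
`u n` has the same coincidences as `u₀`. -/
theorem eventually_eq_iff_eq_of_card_image_eq {ι α : Type*} [Fintype ι] [DecidableEq α]
    [TopologicalSpace α] [T2Space α] {β : Type*} {l : Filter β} {u : β → ι → α} {u₀ : ι → α}
    (hu : Tendsto u l (𝓝 u₀))
    (hcard : ∀ b, (Finset.univ.image (u b)).card = (Finset.univ.image u₀).card) :
    ∀ᶠ b in l, ∀ i j, u b i = u b j ↔ u₀ i = u₀ j := by
  have hne : ∀ᶠ b in l, ∀ i j, u₀ i ≠ u₀ j → u b i ≠ u b j := by
    refine eventually_all.2 fun i => eventually_all.2 fun j => ?_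
    by_cases h : u₀ i = u₀ j
    · simp [h]
    · have hi := tendsto_pi_nhds.1 hu i
      have hj := tendsto_pi_nhds.1 hu j
      filter_upwards [(hi.prodMk_nhds hj).eventually
        (isClosed_diagonal.isOpen_compl.mem_nhds h)] with b hb _
      exact hb
  filter_upwards [hne] with b hb i j
  refine ⟨fun h => by_contra fun h' => hb i j h' h, fun h => ?_⟩
  have : Nonempty α := ⟨u₀ i⟩
  have hfac : Function.FactorsThrough u₀ (u b) :=
    fun i j h => by_contra fun h' => hb i j h' h
  obtain ⟨g, hg⟩ := (Function.factorsThrough_iff _).1 hfac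
  have hinj : Set.InjOn g (Finset.univ.image (u b)) := by
    rw [← Finset.card_image_iff, Finset.image_image, ← hg, hcard b]
  exact hinj (by simp) (by simp) (by simpa [hg] using h)

theorem mshape_map_of_injOn {X Y : Type*} {g : X → Y} {M : Multiset X}
    (hg : Set.InjOn g {x | x ∈ M}) : mshape (M.map g) = mshape M := by
  classical
  have himage : ((M.map g).toFinset).val = M.toFinset.val.map g := by
    rw [Multiset.toFinset_map, Finset.image_val_of_injOn]
    intro x hx y hy
    exact hg (by simpa using hx) (by simpa using hy)
  unfold mshape
  convert_to Multiset.map (fun a => (M.map g).count a) (M.map g).toFinset.val =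
    Multiset.map (fun a => M.count a) M.toFinset.val
  rw [himage, Multiset.map_map]
  refine Multiset.map_congr rfl fun x hx => ?_
  exact Multiset.count_map_eq_count g M hg x (by simpa using hx)

theorem card_mshape {X : Type*} [DecidableEq X] (M : Multiset X) :
    (mshape M).card = M.toFinset.card := by
  unfold mshape
  rw [Multiset.card_map, Finset.card_val]
  congr!

theorem mshape_map_univ_eq_of_eq_iff_eq {ι X : Type*} [Fintype ι] {z z' : ι → X}
    (h : ∀ i j, z i = z j ↔ z' i = z' j) :
    mshape (Finset.univ.val.map z) = mshape (Finset.univ.val.map z') := by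
  rcases isEmpty_or_nonempty ι with _ | ⟨⟨i₀⟩⟩
  · simp [Subsingleton.elim z z']
  have : Nonempty X := ⟨z i₀⟩
  have hfac : Function.FactorsThrough z z' := fun i j hij => (h i j).2 hij
  obtain ⟨g, rfl⟩ := (Function.factorsThrough_iff _).1 hfac
  rw [← Multiset.map_map]
  refine mshape_map_of_injOn fun x hx y hy hxy => ?_
  simp only [Set.mem_ofPred_eq, Multiset.mem_map] at hx hy
  obtain ⟨i, -, rfl⟩ := hx
  obtain ⟨j, -, rfl⟩ := hy
  exact (h i j).1 hxy

theorem Multiset.exists_eq_map_univ {X : Type*} (M : Multiset X) {n : ℕ} (hn : M.card = n) :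
    ∃ z : Fin n → X, M = Finset.univ.val.map z := by
  subst hn
  induction M using Quotient.inductionOn with
  | h l => exact ⟨l.get, by
      change (l : Multiset X) = Finset.univ.val.map l.get
      rw [Fin.univ_val_map, List.ofFn_get]⟩

namespace Polynomial

theorem card_toFinset_roots_sub_C_add_count_cvl {p : ℂ[X]} (hp : 0 < p.natDegree) (w : ℂ) :
    (p - C w).roots.toFinset.card + (cvl p).count w = p.natDegree := by
  have hdeg : (p - C w).natDegree = p.natDegree := natDegree_sub_C
  have h0 : p - C w ≠ 0 := fun h => by simp [h] at hdeg; omega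
  have hp' : derivative p ≠ 0 := fun h => by
    have := derivative_eq_zero.1 h
    omega
  have hcount : (cvl p).count w =
      ∑ r ∈ (p - C w).roots.toFinset, p.derivative.roots.count r := by
    rw [cvl, Multiset.count_map, ← Multiset.sum_count_eq_card (s := (p - C w).roots.toFinset)]
    · refine Finset.sum_congr rfl fun r hr => ?_
      rw [Multiset.count_filter_of_pos]
      simp only [Multiset.mem_toFinset, mem_roots h0, IsRoot.def, eval_sub, eval_C] at hr
      exact (sub_eq_zero.1 hr).symm
    · intro r hr
      simp only [Multiset.mem_filter] at hr
      rw [Multiset.mem_toFinset, mem_roots h0, IsRoot.def, eval_sub, eval_C, ← hr.2, sub_self]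
  rw [hcount, Finset.card_eq_sum_ones, ← Finset.sum_add_distrib, ← hdeg,
    ← IsAlgClosed.card_roots_eq_natDegree, ← Multiset.toFinset_sum_count_eq]
  refine Finset.sum_congr rfl fun r hr => ?_
  have hr' : (p - C w).IsRoot r := by simpa [mem_roots h0] using (Multiset.mem_toFinset.1 hr)
  have := derivative_rootMultiplicity_of_root hr'
  rw [derivative_sub, derivative_C, sub_zero] at this
  rw [count_roots, count_roots, this]
  have := (rootMultiplicity_pos h0).2 hr'
  omega

/-- The number of distinct points in the fibres over the critical values of `p` is determined
by the degree and by the number of distinct critical values. -/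
theorem card_biUnion_fibres_cvl {p : ℂ[X]} (hp : 0 < p.natDegree) :
    ((cvl p).toFinset.biUnion fun w => (p - C w).roots.toFinset).card + (p.natDegree - 1) =
      (cvl p).toFinset.card * p.natDegree := by
  have hne (w : ℂ) : p - C w ≠ 0 := fun h => by
    have hdeg : (p - C w).natDegree = p.natDegree := natDegree_sub_C
    simp [h] at hdeg
    omega
  have hcard : (cvl p).card = p.natDegree - 1 := by
    rw [cvl, Multiset.card_map, IsAlgClosed.card_roots_eq_natDegree, natDegree_derivative]
  rw [Finset.card_biUnion, ← hcard, ← Multiset.toFinset_sum_count_eq, ← Finset.sum_add_distrib,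
    Finset.sum_congr rfl fun w _ => card_toFinset_roots_sub_C_add_count_cvl hp w]
  · simp
  · intro w _ w' _ hww'
    refine Finset.disjoint_left.2 fun r hr hr' => hww' ?_
    simp only [Multiset.mem_toFinset, mem_roots (hne _), IsRoot.def, eval_sub, eval_C] at hr hr'
    rw [← sub_eq_zero.1 hr, ← sub_eq_zero.1 hr']

theorem norm_le_of_isRoot {p : ℂ[X]} {M : ℝ} (hM : 0 ≤ M) (hlead : 1 ≤ ‖p.leadingCoeff‖)
    (hcoeff : ∀ i, ‖p.coeff i‖ ≤ M) {x : ℂ} (hx : p.IsRoot x) : ‖x‖ ≤ M + 1 := by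
  have hp : p ≠ 0 := by
    rintro rfl
    simp at hlead
    linarith
  have h := (hx.norm_lt_cauchyBound hp).le
  lift M to NNReal using hM
  have hc : cauchyBound p ≤ M + 1 := by
    unfold cauchyBound
    gcongr
    have hlead' : 1 ≤ ‖p.leadingCoeff‖₊ := hlead
    exact (div_le_self zero_le hlead').trans (Finset.sup_le fun i _ => hcoeff i)
  exact_mod_cast h.trans hc

theorem roots_eq_of_eval_eq_mul_prod {ι : Type*} [Fintype ι] {p : ℂ[X]} {c : ℂ} (hc : c ≠ 0)
    {z : ι → ℂ} (h : ∀ x, p.eval x = c * ∏ i, (x - z i)) : p.roots = Finset.univ.val.map z := by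
  have : p = C c * (Finset.univ.val.map fun i => X - C (z i)).prod := by
    refine Polynomial.funext fun x => ?_
    rw [h, eval_mul, eval_C, eval_multiset_prod, Multiset.map_map]
    simp
  rw [this, roots_C_mul _ hc, ← roots_multiset_prod_X_sub_C (Finset.univ.val.map z),
    Multiset.map_map]
  rfl

theorem exists_eval_eq_leadingCoeff_mul_prod {p : ℂ[X]} {n : ℕ} (hn : p.natDegree = n) :
    ∃ z : Fin n → ℂ, ∀ x, p.eval x = p.leadingCoeff * ∏ i, (x - z i) := by
  obtain ⟨z, hz⟩ := p.roots.exists_eq_map_univ (IsAlgClosed.card_roots_eq_natDegree.trans hn)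
  refine ⟨z, fun x => ?_⟩
  conv_lhs => rw [(IsAlgClosed.splits p).eq_prod_roots]
  rw [hz, eval_mul, eval_C, eval_multiset_prod, Multiset.map_map, Multiset.map_map,
    Finset.prod_eq_multiset_prod]
  simp only [Function.comp_def, eval_sub, eval_X, eval_C]

end Polynomial

section mcPoly

variable {d : ℕ}

theorem degree_sum_C_mul_X_pow_lt (hd : 1 ≤ d) (a : Fin (d - 1) → ℂ) :
    (∑ i : Fin (d - 1), C (a i) * X ^ (i : ℕ)).degree < (d : WithBot ℕ) := by
  refine (degree_sum_le _ _).trans_lt ((Finset.sup_lt_iff (WithBot.bot_lt_coe d)).2 fun i _ => ?_)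
  exact (degree_C_mul_X_pow_le _ _).trans_lt (Nat.cast_lt.2 (by have := i.2; omega))

theorem mcPoly_monic (hd : 1 ≤ d) (a : Fin (d - 1) → ℂ) : (mcPoly d a).Monic :=
  monic_X_pow_add (degree_sum_C_mul_X_pow_lt hd a)

theorem natDegree_mcPoly (hd : 1 ≤ d) (a : Fin (d - 1) → ℂ) : (mcPoly d a).natDegree = d := by
  refine natDegree_eq_of_degree_eq_some ?_
  rw [mcPoly, degree_add_eq_left_of_degree_lt, degree_X_pow]
  rw [degree_X_pow]
  exact degree_sum_C_mul_X_pow_lt hd a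

theorem leadingCoeff_derivative_mcPoly (hd : 1 ≤ d) (a : Fin (d - 1) → ℂ) :
    (mcPoly d a).derivative.leadingCoeff = d := by
  rw [leadingCoeff, natDegree_derivative, coeff_derivative, natDegree_mcPoly hd,
    Nat.sub_add_cancel hd]
  have h : (mcPoly d a).coeff d = 1 := by
    simpa [Monic, leadingCoeff, natDegree_mcPoly hd] using mcPoly_monic hd a
  rw [h, one_mul, Nat.cast_sub hd]
  simp

theorem norm_coeff_mcPoly_le {a : Fin (d - 1) → ℂ} {M : ℝ} (hM : 0 ≤ M)
    (ha : ‖a‖ ≤ M) (k : ℕ) : ‖(mcPoly d a).coeff k‖ ≤ M + 1 := by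
  rw [mcPoly, coeff_add, finsetSum_coeff, add_comm M]
  refine (norm_add_le _ _).trans (add_le_add ?_ ?_)
  · rw [coeff_X_pow]
    split_ifs <;> simp
  · simp only [coeff_C_mul, coeff_X_pow, mul_ite, mul_one, mul_zero]
    by_cases hk : k < d - 1
    · rw [Finset.sum_eq_single ⟨k, hk⟩]
      · simpa using (norm_le_pi_norm a _).trans ha
      · intro i _ hi
        exact if_neg fun h => hi (Fin.ext h.symm)
      · simp
    · rw [Finset.sum_eq_zero]
      · simpa using hM
      · intro i _
        have := i.2
        exact if_neg (by omega)

theorem norm_coeff_derivative_mcPoly_le (hd : 1 ≤ d) {a : Fin (d - 1) → ℂ} {M : ℝ} (hM : 0 ≤ M)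
    (ha : ‖a‖ ≤ M) (k : ℕ) : ‖(mcPoly d a).derivative.coeff k‖ ≤ (M + 1) * d := by
  rw [coeff_derivative]
  by_cases hk : k + 1 ≤ d
  · rw [norm_mul]
    refine mul_le_mul (norm_coeff_mcPoly_le hM ha _) ?_ (norm_nonneg _) (by positivity)
    rw [← Nat.cast_succ, Complex.norm_natCast]
    exact_mod_cast hk
  · rw [coeff_eq_zero_of_natDegree_lt (by rw [natDegree_mcPoly hd]; omega), zero_mul, norm_zero]
    positivity

theorem continuous_eval_mcPoly :
    Continuous fun q : (Fin (d - 1) → ℂ) × ℂ => (mcPoly d q.1).eval q.2 := by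
  simp only [mcPoly, eval_add, eval_pow, eval_X, eval_finsetSum, eval_mul, eval_C]
  fun_prop

theorem continuous_eval_derivative_mcPoly (x : ℂ) :
    Continuous fun a : Fin (d - 1) → ℂ => (mcPoly d a).derivative.eval x := by
  simp only [mcPoly, derivative_add, derivative_sum, derivative_C_mul, eval_add, eval_finsetSum,
    eval_mul, eval_C]
  fun_prop

/-- `u` lists the critical points of `mcPoly d a` and, for each of them, the points of the fibre
through it, all with multiplicity. -/
def IsFibreEnum (d : ℕ) (a : Fin (d - 1) → ℂ) (u : Fin (d - 1) ⊕ Fin (d - 1) × Fin d → ℂ) :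
    Prop :=
  (∀ x, (mcPoly d a).derivative.eval x = d * ∏ i, (x - u (.inl i))) ∧
    ∀ i x, (mcPoly d a).eval x - (mcPoly d a).eval (u (.inl i)) = ∏ j, (x - u (.inr (i, j)))

theorem exists_isFibreEnum (hd : 1 ≤ d) (a : Fin (d - 1) → ℂ) : ∃ u, IsFibreEnum d a u := by
  obtain ⟨z, hz⟩ := exists_eval_eq_leadingCoeff_mul_prod
    (p := (mcPoly d a).derivative) (n := d - 1) (by rw [natDegree_derivative, natDegree_mcPoly hd])
  have hy (i : Fin (d - 1)) : ∃ y : Fin d → ℂ, ∀ x,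
      (mcPoly d a).eval x - (mcPoly d a).eval (z i) = ∏ j, (x - y j) := by
    have hdeg : (mcPoly d a - C ((mcPoly d a).eval (z i))).natDegree = d := by
      rw [natDegree_sub_C, natDegree_mcPoly hd]
    obtain ⟨y, hy⟩ := exists_eval_eq_leadingCoeff_mul_prod hdeg
    refine ⟨y, fun x => ?_⟩
    have hm : (mcPoly d a - C ((mcPoly d a).eval (z i))).leadingCoeff = 1 :=
      (mcPoly_monic hd a).sub_of_left (degree_C_le.trans_lt
        (by rw [degree_eq_natDegree (mcPoly_monic hd a).ne_zero, natDegree_mcPoly hd]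
            exact_mod_cast hd))
    simpa [hm] using hy x
  choose y hy using hy
  exact ⟨Sum.elim z fun q => y q.1 q.2, by simpa [leadingCoeff_derivative_mcPoly hd] using hz, hy⟩

theorem isClosed_setOf_isFibreEnum :
    IsClosed {q : (Fin (d - 1) → ℂ) × (Fin (d - 1) ⊕ Fin (d - 1) × Fin d → ℂ) |
      IsFibreEnum d q.1 q.2} := by
  simp only [IsFibreEnum, Set.ofPred_and, Set.ofPred_forall]
  refine (isClosed_iInter fun x => isClosed_eq ?_ ?_).inter
    (isClosed_iInter fun i => isClosed_iInter fun x => isClosed_eq ?_ ?_)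
  · exact (continuous_eval_derivative_mcPoly x).comp continuous_fst
  · fun_prop
  · exact (continuous_eval_mcPoly.comp (continuous_fst.prodMk continuous_const)).sub
      (continuous_eval_mcPoly.comp (continuous_fst.prodMk (by fun_prop)))
  · fun_prop

namespace IsFibreEnum

variable {a : Fin (d - 1) → ℂ} {u : Fin (d - 1) ⊕ Fin (d - 1) × Fin d → ℂ}

theorem roots_derivative (hd : 1 ≤ d) (hu : IsFibreEnum d a u) :
    (mcPoly d a).derivative.roots = Finset.univ.val.map fun i => u (.inl i) :=
  roots_eq_of_eval_eq_mul_prod (Nat.cast_ne_zero.2 (by omega)) hu.1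

theorem roots_sub_C (hu : IsFibreEnum d a u) (i : Fin (d - 1)) :
    (mcPoly d a - C ((mcPoly d a).eval (u (.inl i)))).roots =
      Finset.univ.val.map fun j => u (.inr (i, j)) :=
  roots_eq_of_eval_eq_mul_prod one_ne_zero fun x => by simpa using hu.2 i x

theorem card_image_add (hd : 1 ≤ d) (hu : IsFibreEnum d a u) :
    (Finset.univ.image u).card + (d - 1) = (mshape (cvl (mcPoly d a))).card * d := by
  have hdeg := natDegree_mcPoly hd a
  have himage : Finset.univ.image u =
      (cvl (mcPoly d a)).toFinset.biUnion fun w => (mcPoly d a - C w).roots.toFinset := by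
    have hself (i : Fin (d - 1)) : ∃ j, u (.inr (i, j)) = u (.inl i) := by
      have h := hu.2 i (u (.inl i))
      rw [sub_self, eq_comm, Finset.prod_eq_zero_iff] at h
      obtain ⟨j, -, hj⟩ := h
      exact ⟨j, (sub_eq_zero.1 hj).symm⟩
    ext r
    simp only [Finset.mem_image, Finset.mem_univ, true_and, Finset.mem_biUnion,
      Multiset.mem_toFinset, cvl, hu.roots_derivative hd, Multiset.mem_map, Finset.mem_val,
      exists_exists_eq_and, hu.roots_sub_C, Sum.exists, Prod.exists]
    constructor
    · rintro (⟨i, rfl⟩ | ⟨i, j, rfl⟩)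
      · exact ⟨i, hself i⟩
      · exact ⟨i, j, rfl⟩
    · rintro ⟨i, j, rfl⟩
      exact Or.inr ⟨i, j, rfl⟩
  have := card_biUnion_fibres_cvl (p := mcPoly d a) (by omega)
  rwa [← himage, hdeg, ← card_mshape] at this

end IsFibreEnum

theorem exists_norm_le_of_isFibreEnum (hd : 1 ≤ d) {M : ℝ} (hM : 0 ≤ M) :
    ∃ B, ∀ a u, ‖a‖ ≤ M → IsFibreEnum d a u → ‖u‖ ≤ B := by
  set B₁ := (M + 1) * d + 1 with hB₁
  have hd' : (1 : ℝ) ≤ d := by exact_mod_cast hd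
  have hinl {a u} (ha : ‖a‖ ≤ M) (hu : IsFibreEnum d a u) (i : Fin (d - 1)) :
      ‖u (.inl i)‖ ≤ B₁ := by
    refine norm_le_of_isRoot (p := (mcPoly d a).derivative) (by positivity) ?_
      (norm_coeff_derivative_mcPoly_le hd hM ha) ?_
    · rw [leadingCoeff_derivative_mcPoly hd, Complex.norm_natCast]
      exact hd'
    · rw [IsRoot.def, hu.1, Finset.prod_eq_zero (Finset.mem_univ i) (sub_self _), mul_zero]
  obtain ⟨W, hW⟩ := ((isCompact_closedBall (0 : Fin (d - 1) → ℂ) M).prod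
    (isCompact_closedBall (0 : ℂ) B₁)).exists_bound_of_continuousOn
      (continuous_eval_mcPoly (d := d)).continuousOn
  refine ⟨max B₁ (M + 1 + |W| + 1), fun a u ha hu =>
    (pi_norm_le_iff_of_nonneg (le_max_of_le_right (by positivity))).2 ?_⟩
  rintro (i | ⟨i, j⟩)
  · exact (hinl ha hu i).trans (le_max_left _ _)
  · refine le_trans ?_ (le_max_right _ _)
    have hw : ‖(mcPoly d a).eval (u (.inl i))‖ ≤ |W| :=
      (hW (a, u (.inl i)) (by simpa using ⟨ha, hinl ha hu i⟩)).trans (le_abs_self W)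
    refine norm_le_of_isRoot (p := mcPoly d a - C ((mcPoly d a).eval (u (.inl i))))
      (by positivity) ?_ (fun k => ?_) ?_
    · rw [leadingCoeff, natDegree_sub_C, natDegree_mcPoly hd, coeff_sub,
        coeff_C_of_ne_zero (by omega)]
      have h : (mcPoly d a).coeff d = 1 := by
        simpa [Monic, leadingCoeff, natDegree_mcPoly hd] using mcPoly_monic hd a
      simp [h]
    · rw [coeff_sub]
      refine (norm_sub_le _ _).trans (add_le_add (norm_coeff_mcPoly_le hM ha k) ?_)
      rw [coeff_C]
      split_ifs
      · exact hw
      · simp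
    · rw [IsRoot.def, eval_sub, eval_C, hu.2,
        Finset.prod_eq_zero (Finset.mem_univ j) (sub_self _)]

/-- If a sequence of polynomials converges and the number of distinct critical values is the same
along the sequence and at the limit, then some member has the critical point shape of the limit. -/
theorem exists_mshape_roots_derivative_eq (hd : 1 ≤ d) {N : ℕ}
    {a : ℕ → Fin (d - 1) → ℂ} {a₀ : Fin (d - 1) → ℂ} (ha : Tendsto a atTop (𝓝 a₀))
    (hN : ∀ n, (mshape (cvl (mcPoly d (a n)))).card = N)
    (hN₀ : (mshape (cvl (mcPoly d a₀))).card = N) :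
    ∃ n, mshape (mcPoly d (a n)).derivative.roots = mshape (mcPoly d a₀).derivative.roots := by
  obtain ⟨M, hM⟩ := (Metric.isBounded_range_of_tendsto a ha).exists_norm_le
  have hM' (n : ℕ) : ‖a n‖ ≤ M := hM _ ⟨n, rfl⟩
  obtain ⟨B, hB⟩ := exists_norm_le_of_isFibreEnum hd ((norm_nonneg _).trans (hM' 0))
  choose u hu using fun n => exists_isFibreEnum hd (a n)
  obtain ⟨u₀, -, φ, hφ, hlim⟩ := (isCompact_closedBall
    (0 : Fin (d - 1) ⊕ Fin (d - 1) × Fin d → ℂ) B).tendsto_subseq (x := u) fun n =>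
      mem_closedBall_zero_iff.2 (hB _ _ (hM' n) (hu n))
  have hu₀ : IsFibreEnum d a₀ u₀ := by
    have hlim' := (ha.comp hφ.tendsto_atTop).prodMk_nhds hlim
    have hmem := (isClosed_setOf_isFibreEnum (d := d)).mem_of_tendsto hlim'
      (Eventually.of_forall fun n => hu (φ n))
    exact hmem
  have hcard (n : ℕ) :
      (Finset.univ.image ((u ∘ φ) n)).card = (Finset.univ.image u₀).card := by
    have h := (hu (φ n)).card_image_add hd
    have h₀ := hu₀.card_image_add hd
    rw [hN] at h
    rw [hN₀] at h₀
    simp only [Function.comp_apply]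
    omega
  obtain ⟨n, hn⟩ := (eventually_eq_iff_eq_of_card_image_eq hlim hcard).exists
  refine ⟨φ n, ?_⟩
  rw [(hu (φ n)).roots_derivative hd, hu₀.roots_derivative hd]
  exact mshape_map_univ_eq_of_eq_iff_eq fun i j => hn (.inl i) (.inl j)

end mcPoly

/-- A path of monic centered degree-`d` polynomials whose critical value multiset has
constant shape also has critical point multiset of constant shape. -/
theorem stmt_10 (d : ℕ) (hd : 2 ≤ d) (a : Set.Icc (0:ℝ) 1 → (Fin (d - 1) → ℂ))
    (ha : Continuous a)
    (hcvl : ∀ s t : Set.Icc (0:ℝ) 1,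
      mshape (cvl (mcPoly d (a s))) = mshape (cvl (mcPoly d (a t)))) :
    ∀ s t : Set.Icc (0:ℝ) 1,
      mshape ((mcPoly d (a s)).derivative.roots) =
        mshape ((mcPoly d (a t)).derivative.roots) := by
  intro s t
  have hclosed (P : Multiset ℕ → Prop) :
      IsClosed {r | P (mshape (mcPoly d (a r)).derivative.roots)} := by
    refine IsSeqClosed.isClosed fun r r₀ hr hlim => ?_
    obtain ⟨n, hn⟩ := exists_mshape_roots_derivative_eq (by omega)
      ((ha.tendsto r₀).comp hlim) (fun n => congrArg Multiset.card (hcvl (r n) r₀)) rfl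
    have hrn := hr n
    simp only [Set.mem_ofPred_eq] at hrn ⊢
    rwa [← hn]
  let S := mshape (mcPoly d (a t)).derivative.roots
  have hclopen : IsClopen {r | mshape (mcPoly d (a r)).derivative.roots = S} :=
    ⟨hclosed (· = S), isClosed_compl_iff.1 (hclosed (· ≠ S))⟩
  exact Set.eq_univ_iff_forall.1 (hclopen.eq_univ ⟨t, rfl⟩) s
end
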